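/- arXiv:2101.12636 — 2 statements merged into one kernel-verified Lean document; each statement's English description precedes it below -/
import Mathlib

section
/- Let m ≥ 1, N > 2m, α ∈ (0, N), p ≥ 1 and q > 1. If u ∈ C^{2m}(ℝ^N) is a non-negative solution of (−Δ)^m u ≥ (|·|^{−α} * u^p) u^q in ℝ^N with u not identically zero, then min{p, q} > (N − α)/(N − 2m) and p + q > (2N − α)/(N − 2m). -/
open MeasureTheory Filter Metric

/-- The Laplacian of `u : ℝ^N → ℝ`, defined via the second iterated Fréchet derivative. -/
noncomputable def lap {N : ℕ} (u : EuclideanSpace ℝ (Fin N) → ℝ) :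
    EuclideanSpace ℝ (Fin N) → ℝ :=
  fun x => ∑ i : Fin N,
    iteratedFDeriv ℝ 2 u x ![EuclideanSpace.single i 1, EuclideanSpace.single i 1]

/-- `negLapPow m u = (-Δ)^m u`, the `m`-fold iterate of the negative Laplacian. -/
noncomputable def negLapPow {N : ℕ} (m : ℕ) (u : EuclideanSpace ℝ (Fin N) → ℝ) :
    EuclideanSpace ℝ (Fin N) → ℝ :=
  (fun v => fun x => -(lap v x))^[m] u

/-- Condition (K) on the kernel `Ψ`. -/
structure CondK (N : ℕ) (Ψ : ℝ → ℝ) : Prop where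
  pos : ∀ r : ℝ, 0 < r → 0 < Ψ r
  cont : ContinuousOn (fun x : EuclideanSpace ℝ (Fin N) => Ψ ‖x‖)
    {(0 : EuclideanSpace ℝ (Fin N))}ᶜ
  locInt : LocallyIntegrable (fun x : EuclideanSpace ℝ (Fin N) => Ψ ‖x‖) volume
  anti : AntitoneOn Ψ (Set.Ioi (0 : ℝ))
  tendsto : Tendsto (fun r : ℝ => r ^ N * Ψ r) atTop atTop

open scoped ContDiff

section Laplacian

variable {N : ℕ}

theorem lap_eq_sum_fderiv {u : EuclideanSpace ℝ (Fin N) → ℝ} {x : EuclideanSpace ℝ (Fin N)}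
    (hu : DifferentiableAt ℝ (fderiv ℝ u) x) :
    lap u x = ∑ i : Fin N, fderiv ℝ (fun y => fderiv ℝ u y (EuclideanSpace.single i 1)) x
      (EuclideanSpace.single i 1) := by
  refine Finset.sum_congr rfl fun i _ => ?_
  rw [iteratedFDeriv_two_apply, fderiv_clm_apply hu (differentiableAt_const _)]
  simp

theorem lap_congr_nhds {u v : EuclideanSpace ℝ (Fin N) → ℝ} {x : EuclideanSpace ℝ (Fin N)}
    (h : u =ᶠ[nhds x] v) : lap u =ᶠ[nhds x] lap v := by
  filter_upwards [h.iteratedFDeriv ℝ 2] with y hy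
  simp [lap, hy]

theorem ContDiff.differentiable_fderiv {u : EuclideanSpace ℝ (Fin N) → ℝ} (hu : ContDiff ℝ 2 u) :
    Differentiable ℝ (fderiv ℝ u) :=
  (hu.fderiv_right (m := 1) (by norm_num)).differentiable (by norm_num)

theorem contDiff_lap {n k : WithTop ℕ∞} {u : EuclideanSpace ℝ (Fin N) → ℝ} (hu : ContDiff ℝ n u)
    (hk : k + 2 ≤ n) : ContDiff ℝ k (lap u) := by
  have h2 : ContDiff ℝ 2 u := hu.of_le (le_trans (by simp) hk)
  have : lap u = fun x => ∑ i : Fin N, fderiv ℝ (fun y => fderiv ℝ u y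
      (EuclideanSpace.single i 1)) x (EuclideanSpace.single i 1) :=
    funext fun x => lap_eq_sum_fderiv (h2.differentiable_fderiv x)
  rw [this]
  refine ContDiff.sum fun i _ => ?_
  have h1 : ContDiff ℝ (k + 1) (fun y => fderiv ℝ u y (EuclideanSpace.single i 1)) :=
    (hu.fderiv_right (m := k + 1) (by rwa [add_assoc, one_add_one_eq_two])).clm_apply
      contDiff_const
  exact (h1.fderiv_right le_rfl).clm_apply contDiff_const

theorem lap_sub {u v : EuclideanSpace ℝ (Fin N) → ℝ} (hu : ContDiff ℝ 2 u)
    (hv : ContDiff ℝ 2 v) : lap (fun x => u x - v x) = fun x => lap u x - lap v x := by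
  funext x
  have := iteratedFDeriv_sub_apply (i := 2) (x := x) hu.contDiffAt hv.contDiffAt
  simp only [lap, ← Finset.sum_sub_distrib]
  exact Finset.sum_congr rfl fun i _ => by
    change iteratedFDeriv ℝ 2 (u - v) x _ = _
    rw [this]; rfl

theorem lap_const_mul {u : EuclideanSpace ℝ (Fin N) → ℝ} {x : EuclideanSpace ℝ (Fin N)}
    (hu : ContDiffAt ℝ 2 u x) (c : ℝ) : lap (fun x => c * u x) x = c * lap u x := by
  have := iteratedFDeriv_const_smul_apply (i := 2) (a := c) hu
  simp only [lap, Finset.mul_sum]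
  exact Finset.sum_congr rfl fun i _ => by
    change iteratedFDeriv ℝ 2 (c • u) x _ = _
    rw [this]; rfl

theorem lap_const (c : ℝ) :
    lap (fun _ : EuclideanSpace ℝ (Fin N) => c) = fun _ => 0 := by
  funext x
  rw [lap_eq_sum_fderiv (by simp)]
  simp

theorem lap_comp_smul {u : EuclideanSpace ℝ (Fin N) → ℝ} (hu : ContDiff ℝ 2 u) (a : ℝ) :
    lap (fun x => u (a • x)) = fun x => a ^ 2 * lap u (a • x) := by
  funext x
  have hd := hu.differentiable_fderiv
  have h1 : ∀ v : EuclideanSpace ℝ (Fin N) → ℝ, Differentiable ℝ v →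
      ∀ y, fderiv ℝ (fun x => v (a • x)) y = a • fderiv ℝ v (a • y) := fun v hv y => by
    have h := (hv (a • y)).hasFDerivAt.comp y ((hasFDerivAt_id y).const_smul a)
    refine h.fderiv.trans ?_
    ext w; simp
  have hu1 : Differentiable ℝ u := hu.differentiable (by norm_num)
  have hc : ContDiff ℝ 2 (fun x => u (a • x)) := hu.comp (contDiff_const_smul a)
  rw [lap_eq_sum_fderiv (hc.differentiable_fderiv x), lap_eq_sum_fderiv (hd _), Finset.mul_sum]
  refine Finset.sum_congr rfl fun i _ => ?_
  have h2 : (fun y => fderiv ℝ (fun x => u (a • x)) y (EuclideanSpace.single i 1)) =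
      fun y => (fun z => a * fderiv ℝ u z (EuclideanSpace.single i 1)) (a • y) := by
    funext y; rw [h1 u hu1]; simp
  have hdi : Differentiable ℝ fun z => fderiv ℝ u z (EuclideanSpace.single i 1) :=
    hd.clm_apply (differentiable_const _)
  rw [h2, h1 _ (hdi.const_mul a), fderiv_const_mul (hdi _)]
  simp; ring

theorem lap_norm_rpow {x : EuclideanSpace ℝ (Fin N)} (hx : x ≠ 0) (a : ℝ) :
    lap (fun y => ‖y‖ ^ a) x = a * (a + N - 2) * ‖x‖ ^ (a - 2) := by
  have h1 : ∀ (a : ℝ) (y : EuclideanSpace ℝ (Fin N)), y ≠ 0 →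
      HasFDerivAt (fun y => ‖y‖ ^ a) ((a * ‖y‖ ^ (a - 2)) • innerSL ℝ y) y := fun a y hy => by
    have hy' : 0 < ‖y‖ := norm_pos_iff.2 hy
    have h := (hasStrictFDerivAt_norm_sq y).hasFDerivAt.rpow_const (p := a / 2)
      (Or.inl (by positivity))
    have e : (fun y : EuclideanSpace ℝ (Fin N) => (‖y‖ ^ 2) ^ (a / 2)) = fun y => ‖y‖ ^ a := by
      funext z
      rw [← Real.rpow_natCast, ← Real.rpow_mul (norm_nonneg _)]
      congr 1; push_cast; ring
    rw [e] at h
    refine h.congr_fderiv ?_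
    rw [← Real.rpow_natCast ‖y‖ 2, ← Real.rpow_mul (norm_nonneg _)]
    ext w
    simp
    rw [show (2 : ℝ) * (a / 2 - 1) = a - 2 by ring]; ring
  have hne : ∀ᶠ y in nhds x, y ≠ 0 := isOpen_ne.mem_nhds hx
  have h2 : fderiv ℝ (fun y : EuclideanSpace ℝ (Fin N) => ‖y‖ ^ a) =ᶠ[nhds x]
      fun y => (a * ‖y‖ ^ (a - 2)) • innerSL ℝ y := by
    filter_upwards [hne] with y hy using (h1 a y hy).fderiv
  have hd : DifferentiableAt ℝ (fun y : EuclideanSpace ℝ (Fin N) => (a * ‖y‖ ^ (a - 2)) •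
      innerSL ℝ y) x :=
    ((h1 (a - 2) x hx).differentiableAt.const_mul a).smul (innerSL ℝ).differentiableAt
  rw [lap_eq_sum_fderiv (hd.congr_of_eventuallyEq h2)]
  have h3 : ∀ i : Fin N, fderiv ℝ (fun y => fderiv ℝ (fun y : EuclideanSpace ℝ (Fin N) =>
      ‖y‖ ^ a) y (EuclideanSpace.single i 1)) x (EuclideanSpace.single i 1) =
      a * (a - 2) * ‖x‖ ^ (a - 4) * x i ^ 2 + a * ‖x‖ ^ (a - 2) := fun i => by
    have e : (fun y => fderiv ℝ (fun y : EuclideanSpace ℝ (Fin N) =>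
        ‖y‖ ^ a) y (EuclideanSpace.single i 1)) =ᶠ[nhds x]
        fun y => (a * ‖y‖ ^ (a - 2)) * EuclideanSpace.proj (𝕜 := ℝ) i y := by
      filter_upwards [h2] with y hy
      rw [hy]; simp [EuclideanSpace.inner_single_right]
    rw [e.fderiv_eq]
    have h := ((h1 (a - 2) x hx).const_mul a).mul
      (EuclideanSpace.proj (𝕜 := ℝ) (ι := Fin N) i).hasFDerivAt
    refine (DFunLike.congr_fun h.fderiv _).trans ?_
    simp [EuclideanSpace.inner_single_right]
    rw [show a - 2 - 2 = a - 4 by ring]; ring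
  simp only [h3, Finset.sum_add_distrib, ← Finset.mul_sum]
  rw [← EuclideanSpace.real_norm_sq_eq]
  have hx' : 0 < ‖x‖ := norm_pos_iff.2 hx
  have : ‖x‖ ^ (a - 2) = ‖x‖ ^ (a - 4) * ‖x‖ ^ 2 := by
    rw [← Real.rpow_natCast ‖x‖ 2, ← Real.rpow_add hx']; congr 1; push_cast; ring
  simp [this]; ring

end Laplacian

section Polyharmonic

variable {N : ℕ}

theorem negLapPow_zero (u : EuclideanSpace ℝ (Fin N) → ℝ) : negLapPow 0 u = u := rfl

theorem negLapPow_succ (m : ℕ) (u : EuclideanSpace ℝ (Fin N) → ℝ) :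
    negLapPow (m + 1) u = negLapPow m (fun x => -lap u x) := rfl

theorem negLapPow_succ' (m : ℕ) (u : EuclideanSpace ℝ (Fin N) → ℝ) :
    negLapPow (m + 1) u = fun x => -lap (negLapPow m u) x :=
  Function.iterate_succ_apply' _ m u

theorem contDiff_negLapPow {k : WithTop ℕ∞} : ∀ (m : ℕ) {u : EuclideanSpace ℝ (Fin N) → ℝ},
    ContDiff ℝ (k + 2 * m) u → ContDiff ℝ k (negLapPow m u)
  | 0, u, hu => by simpa [negLapPow_zero] using hu
  | m + 1, u, hu => by
    rw [negLapPow_succ]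
    refine contDiff_negLapPow m (contDiff_lap hu ?_).neg
    push_cast
    rw [mul_add, mul_one, add_assoc]

theorem contDiff_infty_negLapPow (m : ℕ) {u : EuclideanSpace ℝ (Fin N) → ℝ}
    (hu : ContDiff ℝ ∞ u) : ContDiff ℝ ∞ (negLapPow m u) := by
  refine contDiff_infty.2 fun k => contDiff_negLapPow m ?_
  exact_mod_cast contDiff_infty.1 hu (k + 2 * m)

theorem negLapPow_congr_nhds {u v : EuclideanSpace ℝ (Fin N) → ℝ} {x : EuclideanSpace ℝ (Fin N)}
    (m : ℕ) (h : u =ᶠ[nhds x] v) : negLapPow m u =ᶠ[nhds x] negLapPow m v := by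
  induction m with
  | zero => exact h
  | succ m ih =>
    rw [negLapPow_succ', negLapPow_succ']
    filter_upwards [lap_congr_nhds ih] with y hy
    rw [hy]

theorem negLapPow_sub (m : ℕ) {u v : EuclideanSpace ℝ (Fin N) → ℝ} (hu : ContDiff ℝ ∞ u)
    (hv : ContDiff ℝ ∞ v) :
    negLapPow m (fun x => u x - v x) = fun x => negLapPow m u x - negLapPow m v x := by
  induction m with
  | zero => rfl
  | succ m ih =>
    rw [negLapPow_succ', negLapPow_succ', negLapPow_succ', ih,
      lap_sub (contDiff_infty.1 (contDiff_infty_negLapPow m hu) 2)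
        (contDiff_infty.1 (contDiff_infty_negLapPow m hv) 2)]
    funext x; ring

theorem negLapPow_const_mul_comp_smul (m : ℕ) {u : EuclideanSpace ℝ (Fin N) → ℝ}
    (hu : ContDiff ℝ ∞ u) (c a : ℝ) :
    negLapPow m (fun x => c * u (a • x)) =
      fun x => c * a ^ (2 * m) * negLapPow m u (a • x) := by
  induction m with
  | zero => simp [negLapPow_zero]
  | succ m ih =>
    have h2 : ContDiff ℝ 2 (negLapPow m u) :=
      contDiff_infty.1 (contDiff_infty_negLapPow m hu) 2
    rw [negLapPow_succ', negLapPow_succ', ih]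
    funext x
    rw [lap_const_mul (u := fun x => negLapPow m u (a • x))
      (h2.comp (contDiff_const_smul a)).contDiffAt, lap_comp_smul h2]
    ring

theorem negLapPow_const {m : ℕ} (hm : m ≠ 0) (c : ℝ) :
    negLapPow m (fun _ : EuclideanSpace ℝ (Fin N) => c) = fun _ => 0 := by
  induction m with
  | zero => exact absurd rfl hm
  | succ m ih =>
    rw [negLapPow_succ']
    rcases eq_or_ne m 0 with rfl | h
    · simp [negLapPow_zero, lap_const]
    · simp [ih h, lap_const]

theorem negLapPow_norm_rpow (m : ℕ) (a : ℝ) {x : EuclideanSpace ℝ (Fin N)} (hx : x ≠ 0) :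
    negLapPow m (fun y => ‖y‖ ^ a) x =
      (∏ i ∈ Finset.range m, -((a - 2 * i) * (a - 2 * i + N - 2))) * ‖x‖ ^ (a - 2 * m) := by
  induction m generalizing x with
  | zero => simp [negLapPow_zero]
  | succ m ih =>
    have h : negLapPow m (fun y : EuclideanSpace ℝ (Fin N) => ‖y‖ ^ a) =ᶠ[nhds x] fun x =>
        (∏ i ∈ Finset.range m, -((a - 2 * i) * (a - 2 * i + N - 2))) * ‖x‖ ^ (a - 2 * m) := by
      filter_upwards [isOpen_ne.mem_nhds hx] with y hy using ih hy
    have hc : ContDiffAt ℝ 2 (fun x : EuclideanSpace ℝ (Fin N) => ‖x‖ ^ (a - 2 * m)) x :=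
      (contDiffAt_norm ℝ hx).rpow_const_of_ne (norm_ne_zero_iff.2 hx)
    rw [negLapPow_succ']
    beta_reduce
    rw [(lap_congr_nhds h).eq_of_nhds, lap_const_mul hc, lap_norm_rpow hx,
      Finset.prod_range_succ]
    push_cast
    rw [show a - 2 * (m + 1) = a - 2 * m - 2 by ring]
    ring

theorem negLapPow_norm_rpow_eq_zero {m : ℕ} (hm : 1 ≤ m) {x : EuclideanSpace ℝ (Fin N)}
    (hx : x ≠ 0) : negLapPow m (fun y => ‖y‖ ^ (2 * m - N : ℝ)) x = 0 := by
  rw [negLapPow_norm_rpow m _ hx, Finset.prod_eq_zero (i := m - 1), zero_mul]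
  · simp; omega
  · push_cast [Nat.cast_sub hm]; ring

theorem lap_hasCompactSupport {ψ : EuclideanSpace ℝ (Fin N) → ℝ} (hψ : HasCompactSupport ψ) :
    HasCompactSupport (lap ψ) :=
  hψ.mono' fun x hx => by
    contrapose! hx
    have : ψ =ᶠ[nhds x] fun _ => 0 := notMem_tsupport_iff_eventuallyEq.1 hx
    simp [(lap_congr_nhds this).eq_of_nhds, lap_const]

theorem negLapPow_hasCompactSupport (m : ℕ) {ψ : EuclideanSpace ℝ (Fin N) → ℝ}
    (hψ : HasCompactSupport ψ) : HasCompactSupport (negLapPow m ψ) := by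
  induction m with
  | zero => exact hψ
  | succ m ih =>
    rw [negLapPow_succ']
    exact (lap_hasCompactSupport ih).neg

theorem integral_mul_fderiv_eq {u ψ : EuclideanSpace ℝ (Fin N) → ℝ}
    (hu : ContDiff ℝ 1 u) (hψ : ContDiff ℝ 1 ψ) (hs : HasCompactSupport ψ)
    (v : EuclideanSpace ℝ (Fin N)) :
    ∫ x, u x * fderiv ℝ ψ x v = -∫ x, fderiv ℝ u x v * ψ x := by
  have hu' : Continuous fun x => fderiv ℝ u x v :=
    (hu.continuous_fderiv (by norm_num)).clm_apply continuous_const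
  have hψ' : Continuous fun x => fderiv ℝ ψ x v :=
    (hψ.continuous_fderiv (by norm_num)).clm_apply continuous_const
  have hs' : HasCompactSupport fun x => fderiv ℝ ψ x v := hs.fderiv_apply ℝ v
  refine integral_mul_fderiv_eq_neg_fderiv_mul_of_integrable ?_ ?_ ?_
    (fun x _ => hu.differentiable (by norm_num) x) (fun x _ => hψ.differentiable (by norm_num) x)
  · exact (hu'.mul hψ.continuous).integrable_of_hasCompactSupport hs.mul_left
  · exact (hu.continuous.mul hψ').integrable_of_hasCompactSupport hs'.mul_left
  · exact (hu.continuous.mul hψ.continuous).integrable_of_hasCompactSupport hs.mul_left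

theorem integral_lap_mul {u ψ : EuclideanSpace ℝ (Fin N) → ℝ}
    (hu : ContDiff ℝ 2 u) (hψ : ContDiff ℝ 2 ψ) (hs : HasCompactSupport ψ) :
    ∫ x, lap u x * ψ x = ∫ x, u x * lap ψ x := by
  have hd : ∀ (v : EuclideanSpace ℝ (Fin N) → ℝ) (i : Fin N), ContDiff ℝ 2 v →
      ContDiff ℝ 1 (fun y => fderiv ℝ v y (EuclideanSpace.single i 1)) := fun v i hv =>
    (hv.fderiv_right (m := 1) (by norm_num)).clm_apply contDiff_const
  have hd' : ∀ (v : EuclideanSpace ℝ (Fin N) → ℝ) (i : Fin N), ContDiff ℝ 2 v → Continuous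
      (fun x => fderiv ℝ (fun y => fderiv ℝ v y (EuclideanSpace.single i 1)) x
        (EuclideanSpace.single i 1)) := fun v i hv =>
    ((hd v i hv).continuous_fderiv (by norm_num)).clm_apply continuous_const
  have hs' : ∀ i : Fin N, HasCompactSupport
      fun x => fderiv ℝ ψ x (EuclideanSpace.single i 1) := fun i => hs.fderiv_apply ℝ _
  simp only [fun x => lap_eq_sum_fderiv (hu.differentiable_fderiv x),
    fun x => lap_eq_sum_fderiv (hψ.differentiable_fderiv x), Finset.sum_mul, Finset.mul_sum]
  rw [integral_finsetSum, integral_finsetSum]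
  · refine Finset.sum_congr rfl fun i _ => ?_
    rw [integral_mul_fderiv_eq (hu.of_le (by norm_num)) (hd ψ i hψ) (hs' i),
      integral_mul_fderiv_eq (hd u i hu) (hψ.of_le (by norm_num)) hs, neg_neg]
  · exact fun i _ => (hu.continuous.mul (hd' ψ i hψ)).integrable_of_hasCompactSupport
      ((hs' i).fderiv_apply ℝ _).mul_left
  · exact fun i _ => ((hd' u i hu).mul hψ.continuous).integrable_of_hasCompactSupport hs.mul_left

theorem integral_negLapPow_mul (m : ℕ) {u ψ : EuclideanSpace ℝ (Fin N) → ℝ}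
    (hu : ContDiff ℝ (2 * m) u) (hψ : ContDiff ℝ ∞ ψ) (hs : HasCompactSupport ψ) :
    ∫ x, negLapPow m u x * ψ x = ∫ x, u x * negLapPow m ψ x := by
  induction m generalizing u with
  | zero => rfl
  | succ m ih =>
    have h2 : (2 * m : WithTop ℕ∞) + 2 = 2 * (m + 1 : ℕ) := by push_cast; ring
    have hu2 : ContDiff ℝ 2 u := hu.of_le (h2 ▸ le_add_self)
    rw [negLapPow_succ, ih (contDiff_lap hu h2.le).neg, negLapPow_succ']
    simp only [neg_mul, mul_neg, integral_neg]
    rw [integral_lap_mul hu2 (contDiff_infty.1 (contDiff_infty_negLapPow m hψ) 2)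
      (negLapPow_hasCompactSupport m hs)]

end Polyharmonic

section TestFunctions

variable {N : ℕ}

/-- The closed annulus `R ≤ ‖x‖ ≤ 2 * R`. -/
def closedAnnulus (N : ℕ) (R : ℝ) : Set (EuclideanSpace ℝ (Fin N)) :=
  {x | R ≤ ‖x‖ ∧ ‖x‖ ≤ 2 * R}

theorem mem_closedAnnulus {R : ℝ} {x : EuclideanSpace ℝ (Fin N)} :
    x ∈ closedAnnulus N R ↔ R ≤ ‖x‖ ∧ ‖x‖ ≤ 2 * R := Iff.rfl

theorem isCompact_closedAnnulus (R : ℝ) : IsCompact (closedAnnulus N R) := by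
  refine (isCompact_closedBall (0 : EuclideanSpace ℝ (Fin N)) (2 * R)).of_isClosed_subset
    ((isClosed_le continuous_const continuous_norm).inter
      (isClosed_le continuous_norm continuous_const)) fun x hx => ?_
  simpa using hx.2

theorem smul_mem_closedAnnulus {R : ℝ} (hR : 0 < R) {x : EuclideanSpace ℝ (Fin N)} :
    R⁻¹ • x ∈ closedAnnulus N 1 ↔ x ∈ closedAnnulus N R := by
  simp only [mem_closedAnnulus, norm_smul, norm_inv, Real.norm_eq_abs,
    abs_of_pos hR, mul_one]
  rw [inv_mul_eq_div, le_div_iff₀ hR, div_le_iff₀ hR, one_mul]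

/-- A smooth cutoff equal to `1` on the unit ball and vanishing off the ball of radius `2`. -/
noncomputable def cutoff (N : ℕ) : ContDiffBump (0 : EuclideanSpace ℝ (Fin N)) :=
  ⟨1, 2, one_pos, one_lt_two⟩

theorem cutoff_eq_one {x : EuclideanSpace ℝ (Fin N)} (hx : ‖x‖ ≤ 1) : cutoff N x = 1 :=
  (cutoff N).one_of_mem_closedBall (by simpa [cutoff] using hx)

theorem cutoff_eq_zero {x : EuclideanSpace ℝ (Fin N)} (hx : 2 ≤ ‖x‖) : cutoff N x = 0 :=
  (cutoff N).zero_of_le_dist (by simpa [cutoff] using hx)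

/-- The polyharmonic fundamental profile `‖x‖ ^ (2 * m - N)`, cut off near the origin. -/
noncomputable def outerProfile (N m : ℕ) (x : EuclideanSpace ℝ (Fin N)) : ℝ :=
  (1 - cutoff N x) * ‖x‖ ^ (2 * m - N : ℝ)

theorem contDiff_outerProfile (m : ℕ) : ContDiff ℝ ∞ (outerProfile N m) := by
  rw [contDiff_iff_contDiffAt]
  intro x
  rcases eq_or_ne x 0 with rfl | hx
  · refine (contDiffAt_const (c := (0 : ℝ))).congr_of_eventuallyEq ?_
    filter_upwards [ball_mem_nhds (0 : EuclideanSpace ℝ (Fin N)) one_pos] with y hy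
    rw [outerProfile, cutoff_eq_one (by simpa using (mem_ball.1 hy).le), sub_self, zero_mul]
  · exact (contDiffAt_const.sub (cutoff N).contDiffAt).mul
      ((contDiffAt_norm ℝ hx).rpow_const_of_ne (norm_ne_zero_iff.2 hx))

theorem negLapPow_eq_zero_of_notMem_closedAnnulus {m : ℕ} (hm : 1 ≤ m)
    {g : EuclideanSpace ℝ (Fin N) → ℝ} {c : ℝ} (h1 : ∀ x, ‖x‖ < 1 → g x = c)
    (h2 : ∀ x, 2 < ‖x‖ → g x = ‖x‖ ^ (2 * m - N : ℝ)) {x : EuclideanSpace ℝ (Fin N)}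
    (hx : x ∉ closedAnnulus N 1) : negLapPow m g x = 0 := by
  simp only [mem_closedAnnulus, not_and_or, not_le, mul_one] at hx
  rcases hx with hx | hx
  · have h : g =ᶠ[nhds x] fun _ => c := by
      filter_upwards [(isOpen_lt continuous_norm continuous_const).mem_nhds hx] with y hy
      exact h1 y hy
    rw [(negLapPow_congr_nhds m h).eq_of_nhds, negLapPow_const (by omega)]
  · have h : g =ᶠ[nhds x] fun y => ‖y‖ ^ (2 * m - N : ℝ) := by
      filter_upwards [(isOpen_lt continuous_const continuous_norm).mem_nhds hx] with y hy
      exact h2 y hy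
    rw [(negLapPow_congr_nhds m h).eq_of_nhds, negLapPow_norm_rpow_eq_zero hm]
    exact norm_pos_iff.1 (by linarith)

theorem exists_abs_negLapPow_le {m : ℕ} (hm : 1 ≤ m)
    {g : EuclideanSpace ℝ (Fin N) → ℝ} (hg : ContDiff ℝ ∞ g) {c : ℝ}
    (h1 : ∀ x, ‖x‖ < 1 → g x = c) (h2 : ∀ x, 2 < ‖x‖ → g x = ‖x‖ ^ (2 * m - N : ℝ)) :
    ∃ C : ℝ, ∀ x, |negLapPow m g x| ≤ (closedAnnulus N 1).indicator (fun _ => C) x := by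
  obtain ⟨C, hC⟩ := (isCompact_closedAnnulus (N := N) 1).exists_bound_of_continuousOn
    (contDiff_infty_negLapPow m hg).continuous.continuousOn
  refine ⟨C, fun x => ?_⟩
  by_cases hx : x ∈ closedAnnulus N 1
  · simpa [hx] using hC x hx
  · simp [hx, negLapPow_eq_zero_of_notMem_closedAnnulus hm h1 h2 hx]

theorem scaled_abs_negLapPow_le {m : ℕ} {g : EuclideanSpace ℝ (Fin N) → ℝ}
    (hg : ContDiff ℝ ∞ g) {C R : ℝ} (hR : 0 < R)
    (hC : ∀ x, |negLapPow m g x| ≤ (closedAnnulus N 1).indicator (fun _ => C) x)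
    (x : EuclideanSpace ℝ (Fin N)) :
    |negLapPow m (fun x => R ^ (2 * m - N : ℝ) * g (R⁻¹ • x)) x| ≤
      (closedAnnulus N R).indicator (fun _ => (R ^ N)⁻¹ * C) x := by
  have hpow : R ^ (2 * m - N : ℝ) * R⁻¹ ^ (2 * m) = (R ^ N)⁻¹ := by
    rw [Real.rpow_sub hR, Real.rpow_natCast, inv_pow, show (2 * m : ℝ) = ((2 * m : ℕ) : ℝ) by
      push_cast; rfl, Real.rpow_natCast]
    field_simp
  rw [negLapPow_const_mul_comp_smul m hg, hpow, abs_mul, abs_of_pos (by positivity)]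
  refine (mul_le_mul_of_nonneg_left (hC _) (by positivity)).trans_eq ?_
  by_cases hx : x ∈ closedAnnulus N R
  · simp [hx, (smul_mem_closedAnnulus hR).2 hx]
  · simp [hx, mt (smul_mem_closedAnnulus hR).1 hx]

theorem exists_polyharmonic_test_function {m : ℕ} (hm : 1 ≤ m) :
    ∃ C > 0, ∀ R S : ℝ, 0 < R → 2 * R ≤ S → ∃ T : EuclideanSpace ℝ (Fin N) → ℝ,
      ContDiff ℝ ∞ T ∧ HasCompactSupport T ∧ (∀ x, 0 ≤ T x) ∧
      (∀ x, ‖x‖ ≤ R → R ^ (2 * m - N : ℝ) ≤ T x) ∧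
      ∀ x, |negLapPow m T x| ≤ (closedAnnulus N R).indicator (fun _ => (R ^ N)⁻¹ * C) x +
        (closedAnnulus N S).indicator (fun _ => (S ^ N)⁻¹ * C) x := by
  have hη : ContDiff ℝ ∞ (cutoff N : EuclideanSpace ℝ (Fin N) → ℝ) := (cutoff N).contDiff
  have hW := contDiff_outerProfile (N := N) m
  have hW2 : ∀ x : EuclideanSpace ℝ (Fin N), 2 < ‖x‖ →
      outerProfile N m x = ‖x‖ ^ (2 * m - N : ℝ) := fun x hx => by
    rw [outerProfile, cutoff_eq_zero hx.le, sub_zero, one_mul]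
  have hW1 : ∀ x : EuclideanSpace ℝ (Fin N), ‖x‖ < 1 → outerProfile N m x = 0 := fun x hx => by
    rw [outerProfile, cutoff_eq_one hx.le, sub_self, zero_mul]
  obtain ⟨C₁, hC₁⟩ := exists_abs_negLapPow_le hm hW hW1 hW2
  have hG : ContDiff ℝ ∞ fun x => cutoff N x + outerProfile N m x := hη.add hW
  obtain ⟨C₂, hC₂⟩ := exists_abs_negLapPow_le hm hG (c := 1)
    (fun x hx => by rw [hW1 x hx, cutoff_eq_one hx.le, add_zero])
    (fun x hx => by rw [hW2 x hx, cutoff_eq_zero hx.le, zero_add])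
  refine ⟨max 1 (max C₁ C₂), by positivity, fun R S hR hS => ?_⟩
  have hS0 : 0 < S := by linarith
  have hsc : ∀ {r : ℝ}, 0 < r → ∀ x : EuclideanSpace ℝ (Fin N),
      r ^ (2 * m - N : ℝ) * outerProfile N m (r⁻¹ • x) =
        (1 - cutoff N (r⁻¹ • x)) * ‖x‖ ^ (2 * m - N : ℝ) := fun {r} hr x => by
    rw [outerProfile, norm_smul, norm_inv, Real.norm_eq_abs, abs_of_pos hr,
      Real.mul_rpow (by positivity) (norm_nonneg _), Real.inv_rpow hr.le]
    field_simp
  have hnorm : ∀ {r : ℝ}, 0 < r → ∀ x : EuclideanSpace ℝ (Fin N), ‖r⁻¹ • x‖ = ‖x‖ / r :=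
    fun {r} hr x => by
      rw [norm_smul, norm_inv, Real.norm_eq_abs, abs_of_pos hr, inv_mul_eq_div]
  have hTe : ∀ x : EuclideanSpace ℝ (Fin N),
      R ^ (2 * m - N : ℝ) * (cutoff N (R⁻¹ • x) + outerProfile N m (R⁻¹ • x)) -
        S ^ (2 * m - N : ℝ) * outerProfile N m (S⁻¹ • x) =
      R ^ (2 * m - N : ℝ) * cutoff N (R⁻¹ • x) +
        ‖x‖ ^ (2 * m - N : ℝ) * (cutoff N (S⁻¹ • x) - cutoff N (R⁻¹ • x)) := fun x => by
    rw [mul_add, hsc hR, hsc hS0]; ring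
  have hmono : ∀ x : EuclideanSpace ℝ (Fin N), cutoff N (R⁻¹ • x) ≤ cutoff N (S⁻¹ • x) :=
    fun x => by
      rcases le_total ‖x‖ S with h | h
      · rw [cutoff_eq_one (x := S⁻¹ • x) (by rw [hnorm hS0]; exact (div_le_one hS0).2 h)]
        exact (cutoff N).le_one
      · rw [cutoff_eq_zero (x := R⁻¹ • x)
          (by rw [hnorm hR, le_div_iff₀ hR]; exact hS.trans h)]
        exact (cutoff N).nonneg
  have hR0 : 0 < R ^ (2 * m - N : ℝ) := Real.rpow_pos_of_pos hR _
  have hGR : ContDiff ℝ ∞ fun x : EuclideanSpace ℝ (Fin N) =>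
      R ^ (2 * m - N : ℝ) * (cutoff N (R⁻¹ • x) + outerProfile N m (R⁻¹ • x)) :=
    contDiff_const.mul (hG.comp (contDiff_const_smul R⁻¹))
  have hWS : ContDiff ℝ ∞ fun x : EuclideanSpace ℝ (Fin N) =>
      S ^ (2 * m - N : ℝ) * outerProfile N m (S⁻¹ • x) :=
    contDiff_const.mul (hW.comp (contDiff_const_smul S⁻¹))
  refine ⟨fun x => R ^ (2 * m - N : ℝ) * (cutoff N (R⁻¹ • x) + outerProfile N m (R⁻¹ • x)) -
    S ^ (2 * m - N : ℝ) * outerProfile N m (S⁻¹ • x), hGR.sub hWS, ?_, fun x => ?_,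
    fun x hx => ?_, fun x => ?_⟩
  · refine HasCompactSupport.intro (isCompact_closedBall 0 (2 * S)) fun x hx => ?_
    have hx' : 2 * S < ‖x‖ := by simpa using hx
    rw [hTe, cutoff_eq_zero (x := R⁻¹ • x) (by rw [hnorm hR, le_div_iff₀ hR]; linarith),
      cutoff_eq_zero (x := S⁻¹ • x) (by rw [hnorm hS0, le_div_iff₀ hS0]; linarith)]
    simp
  · beta_reduce
    rw [hTe]
    have := sub_nonneg.2 (hmono x)
    have := (cutoff N).nonneg (x := R⁻¹ • x)
    positivity
  · beta_reduce
    rw [hTe]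
    have h := sub_nonneg.2 (hmono x)
    rw [cutoff_eq_one (x := R⁻¹ • x) (by rw [hnorm hR]; exact (div_le_one hR).2 hx)] at h ⊢
    have : 0 ≤ ‖x‖ ^ (2 * m - N : ℝ) * (cutoff N (S⁻¹ • x) - 1) := by positivity
    linarith
  · rw [negLapPow_sub m hGR hWS]
    refine (abs_sub _ _).trans (add_le_add ?_ ?_)
    · refine (scaled_abs_negLapPow_le hG hR hC₂ x).trans
        (Set.indicator_le_indicator ?_)
      gcongr; simp
    · refine (scaled_abs_negLapPow_le hW hS0 hC₁ x).trans
        (Set.indicator_le_indicator ?_)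
      gcongr; simp

theorem setIntegral_ball_negLapPow_le {m : ℕ} (hm : 1 ≤ m) : ∃ C > 0,
    ∀ u : EuclideanSpace ℝ (Fin N) → ℝ, ContDiff ℝ (2 * m) u → (∀ x, 0 ≤ u x) →
      (∀ x, 0 ≤ negLapPow m u x) →
      Tendsto (fun R : ℝ => (R ^ N)⁻¹ * ∫ x in closedAnnulus N R, u x) atTop (nhds 0) →
      ∀ R : ℝ, 0 < R → R ^ (2 * m - N : ℝ) * ∫ x in ball 0 R, negLapPow m u x ≤
        C * (R ^ N)⁻¹ * ∫ x in closedAnnulus N R, u x := by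
  obtain ⟨C, hC, h⟩ := exists_polyharmonic_test_function (N := N) hm
  refine ⟨C, hC, fun u hu hu0 hf hlim R hR => ?_⟩
  have huc : Continuous u := hu.continuous
  have hfc : Continuous (negLapPow m u) :=
    (contDiff_negLapPow (k := 0) m (by simpa using hu)).continuous
  have hint : ∀ (g : EuclideanSpace ℝ (Fin N) → ℝ), Continuous g → ∀ r : ℝ,
      IntegrableOn g (closedAnnulus N r) := fun g hg r =>
    hg.continuousOn.integrableOn_compact (isCompact_closedAnnulus r)
  have key : ∀ S : ℝ, 2 * R ≤ S → R ^ (2 * m - N : ℝ) * ∫ x in ball 0 R, negLapPow m u x ≤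
      C * (R ^ N)⁻¹ * (∫ x in closedAnnulus N R, u x) +
        C * ((S ^ N)⁻¹ * ∫ x in closedAnnulus N S, u x) := fun S hS => by
    obtain ⟨T, hT, hTs, hT0, hTR, hTb⟩ := h R S hR hS
    have hfT : Integrable fun x => negLapPow m u x * T x :=
      (hfc.mul hT.continuous).integrable_of_hasCompactSupport hTs.mul_left
    have hms : ∀ r, MeasurableSet (closedAnnulus N r) := fun r =>
      (isCompact_closedAnnulus r).measurableSet
    have hind : ∀ r, Integrable ((closedAnnulus N r).indicator
        fun x => (r ^ N)⁻¹ * C * u x) := fun r =>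
      IntegrableOn.integrable_indicator ((hint u huc r).const_mul _) (hms r)
    calc R ^ (2 * m - N : ℝ) * ∫ x in ball 0 R, negLapPow m u x
        = ∫ x in ball 0 R, R ^ (2 * m - N : ℝ) * negLapPow m u x :=
          (integral_const_mul _ _).symm
      _ ≤ ∫ x in ball 0 R, negLapPow m u x * T x := by
          refine setIntegral_mono_on ?_ hfT.integrableOn measurableSet_ball fun x hx => ?_
          · exact ((continuous_const.mul hfc).continuousOn.integrableOn_compact
              (isCompact_closedBall 0 R)).mono_set ball_subset_closedBall
          · rw [mul_comm]
            exact mul_le_mul_of_nonneg_left (hTR x (by simpa using (mem_ball.1 hx).le)) (hf x)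
      _ ≤ ∫ x, negLapPow m u x * T x :=
          setIntegral_le_integral hfT (Eventually.of_forall fun x => mul_nonneg (hf x) (hT0 x))
      _ = ∫ x, u x * negLapPow m T x := integral_negLapPow_mul m hu hT hTs
      _ ≤ ∫ x, ((closedAnnulus N R).indicator (fun x => (R ^ N)⁻¹ * C * u x) x +
            (closedAnnulus N S).indicator (fun x => (S ^ N)⁻¹ * C * u x) x) := by
          refine integral_mono ?_ ((hind R).add (hind S)) fun x => ?_
          · exact (huc.mul
              (contDiff_infty_negLapPow m hT).continuous).integrable_of_hasCompactSupport
              (negLapPow_hasCompactSupport m hTs).mul_left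
          · refine (mul_le_mul_of_nonneg_left ((le_abs_self _).trans (hTb x)) (hu0 x)).trans_eq ?_
            simp only [Set.indicator]
            split_ifs <;> ring
      _ = _ := by
          rw [integral_add (hind R) (hind S), integral_indicator (hms R),
            integral_indicator (hms S), integral_const_mul, integral_const_mul]
          ring
  have hl : Tendsto (fun S : ℝ => C * (R ^ N)⁻¹ * (∫ x in closedAnnulus N R, u x) +
      C * ((S ^ N)⁻¹ * ∫ x in closedAnnulus N S, u x)) atTop
      (nhds (C * (R ^ N)⁻¹ * (∫ x in closedAnnulus N R, u x) + C * 0)) :=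
    (hlim.const_mul C).const_add _
  rw [mul_zero, add_zero] at hl
  exact ge_of_tendsto hl ((eventually_ge_atTop (2 * R)).mono key)

end TestFunctions

section Averages

variable {N : ℕ}

theorem le_add_rpow_mul_rpow {s t ε : ℝ} (hs : 1 ≤ s) (ht : 0 ≤ t) (hε : 0 < ε) :
    t ≤ ε + ε ^ (1 - s) * t ^ s := by
  rcases le_or_gt t ε with h | h
  · have : 0 ≤ ε ^ (1 - s) * t ^ s := by positivity
    linarith
  · have ht0 : 0 < t := hε.trans h
    have : t = t ^ (1 - s) * t ^ s := by rw [← Real.rpow_add ht0]; simp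
    have h2 : t ^ (1 - s) * t ^ s ≤ ε ^ (1 - s) * t ^ s :=
      mul_le_mul_of_nonneg_right (Real.rpow_le_rpow_of_nonpos hε h.le (by linarith))
        (by positivity)
    linarith

theorem integrableOn_closedAnnulus {g : EuclideanSpace ℝ (Fin N) → ℝ} (hg : Continuous g)
    (R : ℝ) : IntegrableOn g (closedAnnulus N R) :=
  hg.continuousOn.integrableOn_compact (isCompact_closedAnnulus R)

theorem exists_volume_closedAnnulus_le (N : ℕ) :
    ∃ V > 0, ∀ R : ℝ, 0 < R → volume.real (closedAnnulus N R) ≤ V * R ^ N := by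
  refine ⟨2 ^ N * (volume.real (ball (0 : EuclideanSpace ℝ (Fin N)) 1) + 1), by positivity,
    fun R hR => ?_⟩
  have hsub : closedAnnulus N R ⊆ closedBall (0 : EuclideanSpace ℝ (Fin N)) (2 * R) :=
    fun x hx => by simpa using hx.2
  refine (measureReal_mono hsub (isCompact_closedBall _ _).measure_lt_top.ne).trans ?_
  rw [Measure.addHaar_real_closedBall _ _ (by positivity), finrank_euclideanSpace_fin, mul_pow]
  have : (0 : ℝ) < 2 ^ N * R ^ N := by positivity
  nlinarith

theorem exists_setIntegral_closedAnnulus_le (N : ℕ) :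
    ∃ V > 0, ∀ u : EuclideanSpace ℝ (Fin N) → ℝ, Continuous u → (∀ x, 0 ≤ u x) →
      ∀ s R ε : ℝ, 1 ≤ s → 0 < R → 0 < ε → ∫ x in closedAnnulus N R, u x ≤
        V * R ^ N * ε + ε ^ (1 - s) * ∫ x in closedAnnulus N R, u x ^ s := by
  obtain ⟨V, hV, hvol⟩ := exists_volume_closedAnnulus_le N
  refine ⟨V, hV, fun u hu hu0 s R ε hs hR hε => ?_⟩
  have hus : Continuous fun x => u x ^ s := hu.rpow_const fun x => Or.inr (by linarith)
  calc ∫ x in closedAnnulus N R, u x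
      ≤ ∫ x in closedAnnulus N R, (ε + ε ^ (1 - s) * u x ^ s) :=
        setIntegral_mono (integrableOn_closedAnnulus hu R)
          (integrableOn_closedAnnulus (continuous_const.add (hus.const_mul _)) R)
          fun x => le_add_rpow_mul_rpow hs (hu0 x) hε
    _ = volume.real (closedAnnulus N R) * ε +
          ε ^ (1 - s) * ∫ x in closedAnnulus N R, u x ^ s := by
        rw [integral_add (integrableOn_closedAnnulus continuous_const R)
          (integrableOn_closedAnnulus (hus.const_mul _) R), setIntegral_const,
          integral_const_mul, smul_eq_mul]
    _ ≤ _ := by gcongr; exact hvol R hR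

theorem tendsto_setIntegral_closedAnnulus {g : EuclideanSpace ℝ (Fin N) → ℝ}
    (hg : IntegrableOn g {y | 1 < ‖y‖}) :
    Tendsto (fun R : ℝ => ∫ x in closedAnnulus N R, g x) atTop (nhds 0) := by
  have hms : MeasurableSet {y : EuclideanSpace ℝ (Fin N) | 1 < ‖y‖} :=
    measurableSet_lt measurable_const measurable_norm
  have hmA : ∀ R, MeasurableSet (closedAnnulus N R) := fun R =>
    (isCompact_closedAnnulus R).measurableSet
  have hG : Integrable ({y : EuclideanSpace ℝ (Fin N) | 1 < ‖y‖}.indicator g) :=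
    hg.integrable_indicator hms
  have key : Tendsto (fun R : ℝ => ∫ x, (closedAnnulus N R).indicator
      ({y : EuclideanSpace ℝ (Fin N) | 1 < ‖y‖}.indicator g) x) atTop
      (nhds (∫ _ : EuclideanSpace ℝ (Fin N), (0 : ℝ))) := by
    refine tendsto_integral_filter_of_dominated_convergence
      (fun x => ‖{y : EuclideanSpace ℝ (Fin N) | 1 < ‖y‖}.indicator g x‖)
      (Eventually.of_forall fun R => (hG.indicator (hmA R)).aestronglyMeasurable)
      (Eventually.of_forall fun R => Eventually.of_forall fun x =>
        norm_indicator_le_norm_self _ _) hG.norm (Eventually.of_forall fun x => ?_)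
    refine tendsto_const_nhds.congr' ?_
    filter_upwards [eventually_gt_atTop ‖x‖] with R hR
    rw [Set.indicator_of_notMem fun h => absurd h.1 (not_le.2 hR)]
  rw [integral_zero] at key
  refine key.congr' ?_
  filter_upwards [eventually_gt_atTop (1 : ℝ)] with R hR
  rw [integral_indicator (hmA R)]
  refine setIntegral_congr_fun (hmA R) fun x hx => ?_
  exact Set.indicator_of_mem (show x ∈ {y : EuclideanSpace ℝ (Fin N) | 1 < ‖y‖} from
    hR.trans_le hx.1) g

theorem setIntegral_rpow_closedAnnulus_le {α p : ℝ} (hα : 0 ≤ α) (hp : 0 ≤ p)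
    {u : EuclideanSpace ℝ (Fin N) → ℝ} (hu : Continuous u) (hu0 : ∀ x, 0 ≤ u x)
    (hint : IntegrableOn (fun y => u y ^ p * (‖y‖ / 2) ^ (-α)) {y | 1 < ‖y‖}) {R : ℝ}
    (hR : 1 < R) : ∫ x in closedAnnulus N R, u x ^ p ≤
      R ^ α * ∫ y in closedAnnulus N R, u y ^ p * (‖y‖ / 2) ^ (-α) := by
  have hR0 : 0 < R := by linarith
  rw [← integral_const_mul]
  refine setIntegral_mono_on
    (integrableOn_closedAnnulus (hu.rpow_const fun x => Or.inr hp) R)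
    ((hint.mono_set fun x hx => hR.trans_le hx.1).const_mul _)
    (isCompact_closedAnnulus R).measurableSet fun x hx => ?_
  have hx0 : 0 < ‖x‖ / 2 := by linarith [hx.1]
  have h1 : R ^ (-α) ≤ (‖x‖ / 2) ^ (-α) :=
    Real.rpow_le_rpow_of_nonpos hx0 (by linarith [hx.2]) (by linarith)
  have h2 : R ^ α * R ^ (-α) = 1 := by rw [← Real.rpow_add hR0]; simp
  have h3 : 0 ≤ R ^ α * u x ^ p := by have := hu0 x; positivity
  calc u x ^ p = R ^ α * u x ^ p * R ^ (-α) := by rw [mul_right_comm, h2, one_mul]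
    _ ≤ R ^ α * u x ^ p * (‖x‖ / 2) ^ (-α) := by gcongr
    _ = _ := by ring

theorem tendsto_average_closedAnnulus {α p : ℝ} (hα : 0 ≤ α) (hαN : α < N) (hp : 1 ≤ p)
    {u : EuclideanSpace ℝ (Fin N) → ℝ} (hu : Continuous u) (hu0 : ∀ x, 0 ≤ u x)
    (hint : IntegrableOn (fun y => u y ^ p * (‖y‖ / 2) ^ (-α)) {y | 1 < ‖y‖}) :
    Tendsto (fun R : ℝ => (R ^ N)⁻¹ * ∫ x in closedAnnulus N R, u x) atTop (nhds 0) := by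
  obtain ⟨V, hV, hle⟩ := exists_setIntegral_closedAnnulus_le N
  have hlim := tendsto_setIntegral_closedAnnulus hint
  set t : ℝ := (N - α) / p with ht
  have hp0 : 0 < p := by linarith
  have ht0 : 0 < t := div_pos (by linarith) hp0
  have htp : t * p = N - α := by rw [ht]; field_simp
  have hup : Tendsto (fun R : ℝ => R ^ (-t) *
      (V + ∫ y in closedAnnulus N R, u y ^ p * (‖y‖ / 2) ^ (-α))) atTop (nhds 0) := by
    simpa using (tendsto_rpow_neg_atTop ht0).mul (hlim.const_add V)
  refine squeeze_zero' ?_ ?_ hup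
  · filter_upwards [eventually_gt_atTop (0 : ℝ)] with R hR
    have : 0 ≤ ∫ x in closedAnnulus N R, u x := integral_nonneg hu0
    positivity
  · filter_upwards [eventually_gt_atTop (1 : ℝ)] with R hR
    have hR0 : 0 < R := by linarith
    have h1 := hle u hu hu0 p R (R ^ (-t)) hp hR0 (by positivity)
    have h2 := setIntegral_rpow_closedAnnulus_le hα hp0.le hu hu0 hint hR
    have h3 : (R ^ (-t)) ^ (1 - p) * R ^ α = R ^ N * R ^ (-t) := by
      rw [← Real.rpow_mul hR0.le, ← Real.rpow_add hR0, ← Real.rpow_natCast,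
        ← Real.rpow_add hR0]
      congr 1; linear_combination htp
    rw [inv_mul_le_iff₀ (by positivity)]
    calc _ ≤ _ := h1
      _ ≤ V * R ^ N * R ^ (-t) + (R ^ (-t)) ^ (1 - p) *
          (R ^ α * ∫ y in closedAnnulus N R, u y ^ p * (‖y‖ / 2) ^ (-α)) := by gcongr
      _ = _ := by rw [← mul_assoc, h3]; ring

theorem setIntegral_ball_pos {g : EuclideanSpace ℝ (Fin N) → ℝ} (hg : Continuous g)
    (hg0 : ∀ x, 0 ≤ g x) {x₀ : EuclideanSpace ℝ (Fin N)} (hx₀ : g x₀ ≠ 0) {R : ℝ}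
    (hR : ‖x₀‖ < R) : 0 < ∫ x in ball 0 R, g x := by
  rw [setIntegral_pos_iff_support_of_nonneg_ae (Eventually.of_forall hg0)
    ((hg.continuousOn.integrableOn_compact (isCompact_closedBall 0 R)).mono_set
      ball_subset_closedBall)]
  exact (hg.isOpen_support.inter isOpen_ball).measure_pos volume ⟨x₀, hx₀, by simpa using hR⟩

end Averages

section Potential

variable {N : ℕ} {α p : ℝ} {u : EuclideanSpace ℝ (Fin N) → ℝ}

theorem locallyIntegrable_norm_sub_rpow (hN : 1 ≤ N) (hαN : α < N)
    (x : EuclideanSpace ℝ (Fin N)) :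
    LocallyIntegrable fun y : EuclideanSpace ℝ (Fin N) => ‖y - x‖ ^ (-α) := by
  have h : LocallyIntegrable fun y : EuclideanSpace ℝ (Fin N) => ‖y‖ ^ (-α) := by
    refine locallyIntegrable_of_norm_le_rpow (C := 1) (α := α) (by simpa using hN)
      (by simpa using hαN) (Eventually.of_forall fun y => ?_)
      (measurable_norm.pow_const (-α)).aestronglyMeasurable
    rw [Real.norm_of_nonneg (by positivity), one_mul]
  exact (locallyIntegrable_map_homeomorph (f := fun y => ‖y‖ ^ (-α)) (μ := volume)
    (Homeomorph.subRight x)).1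
    (by rw [Homeomorph.coe_subRight, map_sub_right_eq_self]; exact h)

theorem integrable_rpow_mul_norm_sub_rpow (hN : 1 ≤ N) (hα : 0 ≤ α) (hαN : α < N) (hp : 0 ≤ p)
    (hu : Continuous u) (hu0 : ∀ x, 0 ≤ u x)
    (hint : IntegrableOn (fun y => u y ^ p * (‖y‖ / 2) ^ (-α)) {y | 1 < ‖y‖})
    (x : EuclideanSpace ℝ (Fin N)) :
    Integrable fun y : EuclideanSpace ℝ (Fin N) => u y ^ p * ‖y - x‖ ^ (-α) := by
  have hup : Continuous fun y => u y ^ p := hu.rpow_const fun x => Or.inr hp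
  set K := closedBall (0 : EuclideanSpace ℝ (Fin N)) (2 * ‖x‖ + 1)
  have hK : IntegrableOn (fun y => u y ^ p * ‖y - x‖ ^ (-α)) K :=
    ((locallyIntegrable_norm_sub_rpow hN hαN x).integrableOn_isCompact
      (isCompact_closedBall _ _)).continuousOn_mul hup.continuousOn (isCompact_closedBall _ _)
  have hKc : IntegrableOn (fun y => u y ^ p * ‖y - x‖ ^ (-α)) Kᶜ := by
    have hsub : Kᶜ ⊆ {y : EuclideanSpace ℝ (Fin N) | 1 < ‖y‖} := fun y hy => by
      have : 2 * ‖x‖ + 1 < ‖y‖ := by simpa [K] using hy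
      exact (by linarith [norm_nonneg x] : 1 < ‖y‖)
    refine (hint.mono_set hsub).mono' (hup.measurable.mul
      ((measurable_id.sub_const x).norm.pow_const (-α))).aestronglyMeasurable ?_
    filter_upwards [ae_restrict_mem measurableSet_closedBall.compl] with y hy
    have hy' : 2 * ‖x‖ + 1 < ‖y‖ := by simpa [K] using hy
    have h1 : ‖y‖ / 2 ≤ ‖y - x‖ := by
      linarith [norm_sub_norm_le y x]
    rw [Real.norm_of_nonneg (by have := hu0 y; positivity)]
    exact mul_le_mul_of_nonneg_left (Real.rpow_le_rpow_of_nonpos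
      (by linarith [norm_nonneg x]) h1 (by linarith)) (Real.rpow_nonneg (hu0 y) _)
  simpa using hK.union hKc

theorem rpow_mul_setIntegral_le_potential (hN : 1 ≤ N) (hα : 0 ≤ α) (hu0 : ∀ x, 0 ≤ u x)
    {x : EuclideanSpace ℝ (Fin N)}
    (hI : Integrable fun y : EuclideanSpace ℝ (Fin N) => u y ^ p * ‖y - x‖ ^ (-α))
    {S : Set (EuclideanSpace ℝ (Fin N))} (hS : MeasurableSet S)
    (hSu : IntegrableOn (fun y => u y ^ p) S) {r : ℝ} (hr : ∀ y ∈ S, ‖y - x‖ ≤ r) :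
    r ^ (-α) * ∫ y in S, u y ^ p ≤ ∫ y, u y ^ p * ‖y - x‖ ^ (-α) := by
  have : NeZero N := ⟨by omega⟩
  have hne : ∀ᵐ y : EuclideanSpace ℝ (Fin N), y ≠ x := by
    simp [ae_iff]
  rw [← integral_const_mul]
  refine (setIntegral_mono_on_ae (hSu.const_mul _) hI.integrableOn hS ?_).trans
    (setIntegral_le_integral hI (Eventually.of_forall fun y => ?_))
  · filter_upwards [hne] with y hy hyS
    rw [mul_comm]
    exact mul_le_mul_of_nonneg_left (Real.rpow_le_rpow_of_nonpos
      (norm_pos_iff.2 (sub_ne_zero.2 hy)) (hr y hyS) (by linarith)) (Real.rpow_nonneg (hu0 y) _)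
  · have := hu0 y
    beta_reduce
    positivity

end Potential

section Growth

theorem false_of_superlinear_growth {a : ℕ → ℝ} {c q B K : ℝ} (ha : 0 < a 0) (hc : 0 < c)
    (hq : 1 < q) (hB : 0 < B) (hstep : ∀ k, a k + c * a k ^ q ≤ a (k + 1))
    (hbound : ∀ᶠ k in atTop, a k ≤ K * B ^ k) : False := by
  have hge : ∀ k : ℕ, a 0 + k * (c * a 0 ^ q) ≤ a k := by
    intro k
    induction k with
    | zero => simp
    | succ k ih =>
      have h1 : a 0 ≤ a k := by
        have : 0 ≤ (k : ℝ) * (c * a 0 ^ q) := by positivity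
        linarith
      have h2 : c * a 0 ^ q ≤ c * a k ^ q := by gcongr
      push_cast
      linarith [hstep k]
  have htop : Tendsto a atTop atTop :=
    tendsto_atTop_mono hge (tendsto_atTop_add_const_left _ _
      (tendsto_natCast_atTop_atTop.atTop_mul_const (by positivity)))
  have hlarge : ∀ᶠ k in atTop, 2 * B ≤ c * a k ^ (q - 1) :=
    (((tendsto_rpow_atTop (by linarith : 0 < q - 1)).comp htop).const_mul_atTop
      hc).eventually_ge_atTop _
  obtain ⟨k₀, hk₀⟩ := eventually_atTop.1
    ((hlarge.and hbound).and (htop.eventually_gt_atTop 0))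
  have hgeom : ∀ j, (2 * B) ^ j * a k₀ ≤ a (k₀ + j) := by
    intro j
    induction j with
    | zero => simp
    | succ j ih =>
      obtain ⟨⟨h1, -⟩, h3⟩ := hk₀ (k₀ + j) (by omega)
      have h4 : c * a (k₀ + j) ^ q = c * a (k₀ + j) ^ (q - 1) * a (k₀ + j) := by
        rw [mul_assoc, ← Real.rpow_add_one h3.ne', sub_add_cancel]
      calc (2 * B) ^ (j + 1) * a k₀ = 2 * B * ((2 * B) ^ j * a k₀) := by ring
        _ ≤ 2 * B * a (k₀ + j) := by gcongr
        _ ≤ c * a (k₀ + j) ^ (q - 1) * a (k₀ + j) := by gcongr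
        _ ≤ a (k₀ + (j + 1)) := by rw [← h4, ← add_assoc]; linarith [hstep (k₀ + j)]
  have hpos := (hk₀ k₀ le_rfl).2
  obtain ⟨j, hj⟩ := pow_unbounded_of_one_lt (K * B ^ k₀ / a k₀) (one_lt_two (α := ℝ))
  rw [div_lt_iff₀ hpos] at hj
  have h1 := (hgeom j).trans (hk₀ (k₀ + j) (by omega)).1.2
  rw [mul_pow, pow_add, mul_right_comm, ← mul_assoc] at h1
  exact absurd (le_of_mul_le_mul_right h1 (by positivity)) (not_le.2 hj)

variable {N m : ℕ} {u : EuclideanSpace ℝ (Fin N) → ℝ}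

theorem exists_rpow_setIntegral_ball_negLapPow_le (hm : 1 ≤ m) (hu : ContDiff ℝ (2 * m) u)
    (hu0 : ∀ x, 0 ≤ u x) (hf0 : ∀ x, 0 ≤ negLapPow m u x)
    (hav : Tendsto (fun R : ℝ => (R ^ N)⁻¹ * ∫ x in closedAnnulus N R, u x) atTop (nhds 0))
    {s : ℝ} (hs : 1 ≤ s) :
    ∃ C > 0, ∀ R : ℝ, 0 < R → 0 < ∫ x in ball 0 R, negLapPow m u x →
      (∫ x in ball 0 R, negLapPow m u x) ^ s ≤
        C * R ^ ((N - 2 * m) * s - N : ℝ) * ∫ x in closedAnnulus N R, u x ^ s := by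
  obtain ⟨C, hC, hkey⟩ := setIntegral_ball_negLapPow_le (N := N) hm
  obtain ⟨V, hV, hle⟩ := exists_setIntegral_closedAnnulus_le N
  set θ : ℝ := 1 / (2 * C * V) with hθ
  have hθ0 : 0 < θ := by positivity
  refine ⟨2 * C * θ ^ (1 - s), by positivity, fun R hR hF => ?_⟩
  set F := ∫ x in ball 0 R, negLapPow m u x
  set U := ∫ x in closedAnnulus N R, u x ^ s
  set E : ℝ := R ^ (2 * m - N : ℝ) * F with hE
  have hE0 : 0 < E := by positivity
  have h1 : E ≤ C * (R ^ N)⁻¹ * ∫ x in closedAnnulus N R, u x := hkey u hu hu0 hf0 hav R hR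
  have h2 := hle u hu.continuous hu0 s R (θ * E) hs hR (by positivity)
  have h3 : E ≤ E / 2 + C * (R ^ N)⁻¹ * ((θ * E) ^ (1 - s) * U) := by
    calc E ≤ C * (R ^ N)⁻¹ * ∫ x in closedAnnulus N R, u x := h1
      _ ≤ C * (R ^ N)⁻¹ * (V * R ^ N * (θ * E) + (θ * E) ^ (1 - s) * U) := by gcongr
      _ = _ := by rw [hθ]; field_simp
  have h4 : E ^ s = E ^ (s - 1) * E := by rw [← Real.rpow_add_one hE0.ne', sub_add_cancel]
  have h5 : (θ * E) ^ (1 - s) * E ^ (s - 1) = θ ^ (1 - s) := by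
    rw [Real.mul_rpow hθ0.le hE0.le, mul_assoc, ← Real.rpow_add hE0]; simp
  have h6 : E ^ s ≤ 2 * C * θ ^ (1 - s) * (R ^ N)⁻¹ * U := by
    have : 0 < E ^ (s - 1) := by positivity
    calc E ^ s = E ^ (s - 1) * E := h4
      _ ≤ E ^ (s - 1) * (2 * (C * (R ^ N)⁻¹ * ((θ * E) ^ (1 - s) * U))) := by
        gcongr; linarith
      _ = _ := by rw [← h5]; ring
  have h7 : F ^ s = R ^ ((N - 2 * m) * s : ℝ) * E ^ s := by
    rw [hE, Real.mul_rpow (by positivity) hF.le, ← mul_assoc, ← Real.rpow_mul hR.le,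
      ← Real.rpow_add hR]
    ring_nf
    simp
  calc F ^ s = R ^ ((N - 2 * m) * s : ℝ) * E ^ s := h7
    _ ≤ R ^ ((N - 2 * m) * s : ℝ) * (2 * C * θ ^ (1 - s) * (R ^ N)⁻¹ * U) := by gcongr
    _ = _ := by rw [Real.rpow_sub hR, Real.rpow_natCast]; ring

theorem integrableOn_ball {f : EuclideanSpace ℝ (Fin N) → ℝ} (hf : Continuous f) (r : ℝ) :
    IntegrableOn f (ball 0 r) :=
  (hf.continuousOn.integrableOn_compact (isCompact_closedBall 0 r)).mono_set
    ball_subset_closedBall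

theorem setIntegral_ball_mono {f : EuclideanSpace ℝ (Fin N) → ℝ} (hf : Continuous f)
    (hf0 : ∀ x, 0 ≤ f x) {r R : ℝ} (h : r ≤ R) :
    ∫ x in ball 0 r, f x ≤ ∫ x in ball 0 R, f x :=
  setIntegral_mono_set (integrableOn_ball hf R) (Eventually.of_forall hf0)
    (ball_subset_ball h).eventuallyLE

theorem setIntegral_ball_add_setIntegral_closedAnnulus_le
    {f : EuclideanSpace ℝ (Fin N) → ℝ} (hf : Continuous f) (hf0 : ∀ x, 0 ≤ f x) {R : ℝ}
    (hR : 0 < R) : (∫ x in ball 0 R, f x) + ∫ x in closedAnnulus N R, f x ≤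
      ∫ x in ball 0 (4 * R), f x := by
  have hdisj : Disjoint (ball 0 R) (closedAnnulus N R) :=
    Set.disjoint_left.2 fun x hx hx' => absurd hx'.1 (not_le.2 (by simpa using hx))
  rw [← setIntegral_union hdisj (isCompact_closedAnnulus R).measurableSet (integrableOn_ball hf R)
    (integrableOn_closedAnnulus hf R)]
  refine setIntegral_mono_set (integrableOn_ball hf _) (Eventually.of_forall hf0)
    (Set.union_subset (ball_subset_ball (by linarith)) fun x hx => ?_).eventuallyLE
  rw [mem_ball_zero_iff]
  linarith [hx.2]

theorem lt_mul_of_rpow_mul_rpow_le_negLapPow (hm : 1 ≤ m)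
    (hu : ContDiff ℝ (2 * m) u) (hu0 : ∀ x, 0 ≤ u x) (hf0 : ∀ x, 0 ≤ negLapPow m u x)
    (hav : Tendsto (fun R : ℝ => (R ^ N)⁻¹ * ∫ x in closedAnnulus N R, u x) atTop (nhds 0))
    {q β κ R₁ : ℝ} (hq : 1 < q) (hκ : 0 < κ) (hR₁ : 1 ≤ R₁)
    (hF : 0 < ∫ x in ball 0 R₁, negLapPow m u x)
    (hlow : ∀ R ≥ R₁, ∀ x ∈ closedAnnulus N R, κ * R ^ (-β) * u x ^ q ≤ negLapPow m u x) :
    N - β < (N - 2 * m : ℝ) * q := by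
  by_contra! hcon
  have hfc : Continuous (negLapPow m u) := 
    (contDiff_negLapPow (k := 0) m (by simpa using hu)).continuous
  obtain ⟨C, hC, hkey⟩ := setIntegral_ball_negLapPow_le (N := N) hm
  obtain ⟨D, hD, hpow⟩ :=
    exists_rpow_setIntegral_ball_negLapPow_le hm hu hu0 hf0 hav hq.le
  set F : ℝ → ℝ := fun R => ∫ x in ball 0 R, negLapPow m u x
  have hpos : ∀ R, R₁ ≤ R → 0 < F R := fun R hR => hF.trans_le (setIntegral_ball_mono hfc hf0 hR)
  have hgrow : ∀ R, R₁ ≤ R → F R + κ / D * F R ^ q ≤ F (4 * R) := by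
    intro R hR
    have hR0 : 0 < R := by linarith
    have hint : κ * R ^ (-β) * ∫ x in closedAnnulus N R, u x ^ q ≤
        ∫ x in closedAnnulus N R, negLapPow m u x := by
      rw [← integral_const_mul]
      exact setIntegral_mono_on (integrableOn_closedAnnulus (continuous_const.mul
        (hu.continuous.rpow_const fun x => Or.inr (by linarith))) R)
        (integrableOn_closedAnnulus hfc R) (isCompact_closedAnnulus R).measurableSet (hlow R hR)
    have h1 := hpow R hR0 (hpos R hR)
    have h2 : R ^ ((N - 2 * m) * q - N : ℝ) ≤ R ^ (-β) :=
      Real.rpow_le_rpow_of_exponent_le (hR₁.trans hR) (by linarith)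
    have hU : 0 ≤ ∫ x in closedAnnulus N R, u x ^ q :=
      integral_nonneg fun x => Real.rpow_nonneg (hu0 x) _
    have h3 : κ / D * F R ^ q ≤ ∫ x in closedAnnulus N R, negLapPow m u x := by
      calc κ / D * F R ^ q
          ≤ κ / D * (D * R ^ (-β) * ∫ x in closedAnnulus N R, u x ^ q) := by
            gcongr; exact h1.trans (by gcongr)
        _ = κ * R ^ (-β) * ∫ x in closedAnnulus N R, u x ^ q := by field_simp
        _ ≤ _ := hint
    exact (add_le_add_right h3 _).trans
      (setIntegral_ball_add_setIntegral_closedAnnulus_le hfc hf0 hR0)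
  have hupper : ∀ᶠ R in atTop, F R ≤ R ^ (N - 2 * m : ℝ) := by
    have h := hav.const_mul C
    rw [mul_zero] at h
    filter_upwards [h.eventually_le_const zero_lt_one, eventually_gt_atTop (0 : ℝ)] with R h1 hR
    have h2 := hkey u hu hu0 hf0 hav R hR
    rw [mul_assoc] at h2
    have h3 : F R = R ^ (N - 2 * m : ℝ) * (R ^ (2 * m - N : ℝ) * F R) := by
      rw [← mul_assoc, ← Real.rpow_add hR]; simp
    rw [h3]
    exact mul_le_of_le_one_right (by positivity) (h2.trans h1)
  have hseq : Tendsto (fun k : ℕ => (4 : ℝ) ^ k * R₁) atTop atTop :=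
    (tendsto_pow_atTop_atTop_of_one_lt (by norm_num)).atTop_mul_const (by linarith)
  have hR₁0 : 0 < R₁ := by linarith
  refine false_of_superlinear_growth (a := fun k => F (4 ^ k * R₁)) (c := κ / D)
    (B := 4 ^ (N - 2 * m : ℝ)) (K := R₁ ^ (N - 2 * m : ℝ)) (by simpa using hF) (by positivity)
    hq (by positivity) (fun k => ?_) ?_
  · have h := hgrow (4 ^ k * R₁) (le_mul_of_one_le_left hR₁0.le (one_le_pow₀ (by norm_num)))
    rwa [← mul_assoc, ← pow_succ'] at h
  · filter_upwards [hseq.eventually hupper] with k hk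
    rwa [Real.mul_rpow (by positivity) hR₁0.le, ← Real.rpow_pow_comm (by norm_num),
      mul_comm (_ ^ k) (R₁ ^ _)] at hk

end Growth

theorem stmt_6 (N m : ℕ) (hm : 1 ≤ m) (hN : 2 * m < N)
    (α : ℝ) (hα0 : 0 < α) (hαN : α < N)
    (p q : ℝ) (hp : 1 ≤ p) (hq : 1 < q)
    (u : EuclideanSpace ℝ (Fin N) → ℝ)
    (hreg : ContDiff ℝ (2 * m) u)
    (hpos : ∀ x, 0 ≤ u x)
    (hint : IntegrableOn (fun y : EuclideanSpace ℝ (Fin N) => u y ^ p * (‖y‖ / 2) ^ (-α))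
      {y : EuclideanSpace ℝ (Fin N) | 1 < ‖y‖})
    (hineq : ∀ x : EuclideanSpace ℝ (Fin N),
      (∫ y : EuclideanSpace ℝ (Fin N), u y ^ p * ‖y - x‖ ^ (-α)) * u x ^ q
        ≤ negLapPow m u x)
    (hnontriv : ∃ x, u x ≠ 0) :
    ((N : ℝ) - α) / ((N : ℝ) - 2 * m) < min p q ∧
      (2 * (N : ℝ) - α) / ((N : ℝ) - 2 * m) < p + q := by
  have hp0 : 0 < p := by linarith
  have hN1 : 1 ≤ N := by omega
  have hγ : (0 : ℝ) < N - 2 * m := by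
    have : (2 * m : ℝ) < N := by exact_mod_cast hN
    linarith
  have huc : Continuous u := hreg.continuous
  have hup : Continuous fun x => u x ^ p := huc.rpow_const fun x => Or.inr hp0.le
  have hup0 : ∀ x, 0 ≤ u x ^ p := fun x => Real.rpow_nonneg (hpos x) _
  have hf0 : ∀ x, 0 ≤ negLapPow m u x := fun x => le_trans (mul_nonneg (integral_nonneg fun y =>
    mul_nonneg (hup0 y) (by positivity)) (Real.rpow_nonneg (hpos x) _)) (hineq x)
  have hfc : Continuous (negLapPow m u) :=
    (contDiff_negLapPow (k := 0) m (by simpa using hreg)).continuous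
  have hav := tendsto_average_closedAnnulus hα0.le hαN hp huc hpos hint
  have hI := integrable_rpow_mul_norm_sub_rpow hN1 hα0.le hαN hp0.le huc hpos hint
  obtain ⟨x₀, hx₀⟩ := hnontriv
  set R₀ : ℝ := ‖x₀‖ + 1 with hR₀
  have hR₀1 : 1 ≤ R₀ := by linarith [norm_nonneg x₀]
  have hM : 0 < ∫ y in ball 0 R₀, u y ^ p :=
    setIntegral_ball_pos hup hup0 (Real.rpow_pos_of_pos ((hpos x₀).lt_of_ne' hx₀) p).ne'
      (by linarith)
  have hlow_ball : ∀ R ≥ R₀, ∀ x, ‖x‖ ≤ 2 * R → (3 * R) ^ (-α) * (∫ y in ball 0 R₀, u y ^ p) ≤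
      ∫ y, u y ^ p * ‖y - x‖ ^ (-α) := fun R hR x hx =>
    rpow_mul_setIntegral_le_potential hN1 hα0.le hpos (hI x) measurableSet_ball
      (integrableOn_ball hup R₀) fun y hy => by
        have := mem_ball_zero_iff.1 hy
        linarith [norm_sub_le y x]
  have hF₀ : 0 < ∫ x in ball 0 R₀, negLapPow m u x := by
    refine setIntegral_ball_pos hfc hf0 (x₀ := x₀) (ne_of_gt ?_) (by linarith)
    refine lt_of_lt_of_le (mul_pos (lt_of_lt_of_le ?_ (hlow_ball R₀ le_rfl x₀ (by linarith)))
      (Real.rpow_pos_of_pos ((hpos x₀).lt_of_ne' hx₀) _)) (hineq x₀)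
    positivity
  have hF : ∀ R, R₀ ≤ R → ∫ x in ball 0 R₀, negLapPow m u x ≤ ∫ x in ball 0 R, negLapPow m u x :=
    fun R hR => setIntegral_ball_mono hfc hf0 hR
  obtain ⟨D, hD, hpow⟩ := exists_rpow_setIntegral_ball_negLapPow_le hm hreg hpos hf0 hav hp
  set F₀ := ∫ x in ball 0 R₀, negLapPow m u x
  have hannulus : ∀ R, R₀ ≤ R → F₀ ^ p ≤
      D * R ^ ((N - 2 * m) * p - N : ℝ) * ∫ x in closedAnnulus N R, u x ^ p := fun R hR =>
    (Real.rpow_le_rpow hF₀.le (hF R hR) hp0.le).trans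
      (hpow R (by linarith) (hF₀.trans_le (hF R hR)))
  have hp_case : (N : ℝ) - α < p * (N - 2 * m) := by
    by_contra! hcon
    have hlim := (tendsto_setIntegral_closedAnnulus hint).const_mul D
    rw [mul_zero] at hlim
    refine (Real.rpow_pos_of_pos hF₀ p).not_ge (ge_of_tendsto hlim ?_)
    filter_upwards [eventually_ge_atTop R₀, eventually_gt_atTop (1 : ℝ)] with R hR hR1
    have hR0 : 0 < R := by linarith
    set J := ∫ y in closedAnnulus N R, u y ^ p * (‖y‖ / 2) ^ (-α)
    have hJ : 0 ≤ J := integral_nonneg fun y => mul_nonneg (hup0 y) (by positivity)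
    calc F₀ ^ p
        ≤ D * R ^ ((N - 2 * m) * p - N : ℝ) * ∫ x in closedAnnulus N R, u x ^ p := hannulus R hR
      _ ≤ D * R ^ ((N - 2 * m) * p - N : ℝ) * (R ^ α * J) := by
        gcongr
        exact setIntegral_rpow_closedAnnulus_le hα0.le hp0.le huc hpos hint hR1
      _ = D * R ^ ((N - 2 * m) * p - N + α : ℝ) * J := by rw [Real.rpow_add hR0]; ring
      _ ≤ D * 1 * J := by
        gcongr
        exact Real.rpow_le_one_of_one_le_of_nonpos hR1.le (by linarith)
      _ = D * J := by ring
  have hq_case : (N : ℝ) - α < (N - 2 * m) * q := by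
    refine lt_mul_of_rpow_mul_rpow_le_negLapPow hm hreg hpos hf0 hav
      (κ := 3 ^ (-α) * ∫ y in ball 0 R₀, u y ^ p) hq (by positivity) hR₀1 hF₀ fun R hR x hx => ?_
    have hR0 : 0 < R := by linarith
    refine (mul_le_mul_of_nonneg_right ?_ (Real.rpow_nonneg (hpos x) _)).trans (hineq x)
    refine le_of_eq_of_le ?_ (hlow_ball R hR x hx.2)
    rw [Real.mul_rpow (by norm_num) hR0.le]
    ring
  have hpq_case : (N : ℝ) - (α - N + (N - 2 * m) * p) < (N - 2 * m) * q := by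
    refine lt_mul_of_rpow_mul_rpow_le_negLapPow hm hreg hpos hf0 hav
      (κ := 4 ^ (-α) * (F₀ ^ p / D)) hq (by positivity) hR₀1 hF₀ fun R hR x hx => ?_
    have hR0 : 0 < R := by linarith
    refine (mul_le_mul_of_nonneg_right ?_ (Real.rpow_nonneg (hpos x) _)).trans (hineq x)
    have h1 : (4 * R) ^ (-α) * ∫ y in closedAnnulus N R, u y ^ p ≤
        ∫ y, u y ^ p * ‖y - x‖ ^ (-α) :=
      rpow_mul_setIntegral_le_potential hN1 hα0.le hpos (hI x)
        (isCompact_closedAnnulus R).measurableSet (integrableOn_closedAnnulus hup R) fun y hy => by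
          linarith [norm_sub_le y x, hy.2, hx.2]
    refine le_trans ?_ h1
    have h2 : F₀ ^ p / D * R ^ (N - (N - 2 * m) * p : ℝ) ≤
        ∫ y in closedAnnulus N R, u y ^ p := by
      rw [div_mul_eq_mul_div, div_le_iff₀ hD, ← neg_sub, Real.rpow_neg hR0.le, ← div_eq_mul_inv,
        div_le_iff₀ (by positivity)]
      linarith [hannulus R hR]
    calc 4 ^ (-α) * (F₀ ^ p / D) * R ^ (-(α - N + (N - 2 * m) * p))
        = (4 * R) ^ (-α) * (F₀ ^ p / D * R ^ (N - (N - 2 * m) * p : ℝ)) := by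
          rw [Real.mul_rpow (by norm_num) hR0.le, show -(α - N + (N - 2 * m) * p) =
            -α + (N - (N - 2 * m) * p) by ring, Real.rpow_add hR0]
          ring
      _ ≤ _ := by gcongr
  refine ⟨lt_min ((div_lt_iff₀ hγ).2 hp_case) ((div_lt_iff₀ hγ).2 ?_), (div_lt_iff₀ hγ).2 ?_⟩ <;>
    linarith
end

section
/- Let m ≥ 1, N > 2m, α ∈ (0, N), p ≥ 1 and q > 1. If min{p, q} > (N − α)/(N − 2m) and p + q > (2N − α)/(N − 2m), then there exists a function u ∈ C^{2m}(ℝ^N) with u > 0 everywhere, satisfying ∫_{|y|>1} u(y)^p (|y|/2)^{−α} dy < ∞ and (−Δ)^m u ≥ (|·|^{−α} * u^p) u^q pointwise in ℝ^N. -/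
open MeasureTheory Filter Metric

/-- The power `(1 + ‖x‖²)^(-a)` of the Japanese bracket. -/
noncomputable def bracketPow {N : ℕ} (a : ℝ) (x : EuclideanSpace ℝ (Fin N)) : ℝ :=
  (1 + ‖x‖ ^ 2) ^ (-a)

lemma bracketPow_pos {N : ℕ} (a : ℝ) (x : EuclideanSpace ℝ (Fin N)) : 0 < bracketPow a x :=
  Real.rpow_pos_of_pos (by positivity) _

lemma contDiff_bracketPow {N : ℕ} (a : ℝ) {n : WithTop ℕ∞} :
    ContDiff ℝ n (bracketPow a : EuclideanSpace ℝ (Fin N) → ℝ) :=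
  (contDiff_const.add (contDiff_norm_sq ℝ)).rpow_const_of_ne fun x => by positivity

lemma bracketPow_rpow {N : ℕ} (a p : ℝ) (x : EuclideanSpace ℝ (Fin N)) :
    bracketPow a x ^ p = bracketPow (a * p) x := by
  rw [bracketPow, bracketPow, ← Real.rpow_mul (by positivity), neg_mul]

lemma bracketPow_mul {N : ℕ} (a b : ℝ) (x : EuclideanSpace ℝ (Fin N)) :
    bracketPow a x * bracketPow b x = bracketPow (a + b) x := by
  rw [bracketPow, bracketPow, bracketPow, ← Real.rpow_add (by positivity), neg_add]

lemma bracketPow_anti {N : ℕ} {a b : ℝ} (h : a ≤ b) (x : EuclideanSpace ℝ (Fin N)) :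
    bracketPow b x ≤ bracketPow a x :=
  Real.rpow_le_rpow_of_exponent_le (by nlinarith [sq_nonneg ‖x‖]) (by linarith)

lemma norm_sq_mul_bracketPow_add_one {N : ℕ} (a : ℝ) (x : EuclideanSpace ℝ (Fin N)) :
    ‖x‖ ^ 2 * bracketPow (a + 1) x = bracketPow a x - bracketPow (a + 1) x := by
  have h : (0 : ℝ) < 1 + ‖x‖ ^ 2 := by positivity
  have : bracketPow a x = (1 + ‖x‖ ^ 2) * bracketPow (a + 1) x := by
    rw [bracketPow, bracketPow, neg_add, ← sub_eq_add_neg, Real.rpow_sub_one h.ne']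
    field_simp
  rw [this]; ring

lemma hasFDerivAt_bracketPow {N : ℕ} (a : ℝ) (x : EuclideanSpace ℝ (Fin N)) :
    HasFDerivAt (bracketPow a) ((-(2 * a) * bracketPow (a + 1) x) • innerSL ℝ x) x := by
  have h := (((hasStrictFDerivAt_norm_sq x).hasFDerivAt).const_add 1).rpow_const (p := -a)
    (Or.inl (by positivity))
  refine h.congr_fderiv ?_
  ext v
  simp [bracketPow, show -a - 1 = -1 + -a by ring]
  ring

lemma fderiv_fderiv_bracketPow {N : ℕ} (a : ℝ) (x v w : EuclideanSpace ℝ (Fin N)) :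
    fderiv ℝ (fderiv ℝ (bracketPow a)) x v w =
      -(2 * a) * bracketPow (a + 1) x * inner ℝ v w
        + 4 * a * (a + 1) * bracketPow (a + 2) x * inner ℝ x v * inner ℝ x w := by
  have h1 : fderiv ℝ (bracketPow a) =
      fun x : EuclideanSpace ℝ (Fin N) => (-(2 * a) * bracketPow (a + 1) x) • innerSL ℝ x :=
    funext fun x => (hasFDerivAt_bracketPow a x).fderiv
  have h2 := ((hasFDerivAt_bracketPow (a + 1) x).const_mul (-(2 * a))).smul
    (innerSL ℝ (E := EuclideanSpace ℝ (Fin N))).hasFDerivAt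
  have h3 := h2.fderiv
  simp only [Pi.smul_def'] at h3
  rw [h1, h3]
  change -(2 * a) * bracketPow (a + 1) x * inner ℝ v w
    + -(2 * a) * (-(2 * (a + 1)) * bracketPow (a + 1 + 1) x * inner ℝ x v) * inner ℝ x w = _
  rw [show a + 1 + 1 = a + 2 by ring]
  ring

lemma lap_bracketPow {N : ℕ} (a : ℝ) (x : EuclideanSpace ℝ (Fin N)) :
    -lap (bracketPow a) x =
      4 * a * (N / 2 - 1 - a) * bracketPow (a + 1) x
        + 4 * a * (a + 1) * bracketPow (a + 2) x := by
  have h := norm_sq_mul_bracketPow_add_one (a + 1) x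
  rw [show a + 1 + 1 = a + 2 by ring] at h
  have key : lap (bracketPow a) x = -(2 * a) * bracketPow (a + 1) x * N
      + 4 * a * (a + 1) * (‖x‖ ^ 2 * bracketPow (a + 2) x) := by
    simp only [lap, iteratedFDeriv_two_apply, fderiv_fderiv_bracketPow, EuclideanSpace.real_norm_sq_eq,
      Finset.sum_add_distrib, Finset.sum_mul, Finset.mul_sum]
    congr 1
    · simp; ring
    · refine Finset.sum_congr rfl fun i _ => ?_
      simp [EuclideanSpace.inner_single_right]; ring
  rw [key, h]; ring

lemma lap_sum_bracketPow {N : ℕ} (S : Finset ℕ) (c b : ℕ → ℝ) (x : EuclideanSpace ℝ (Fin N)) :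
    lap (fun x => ∑ k ∈ S, c k * bracketPow (b k) x) x =
      ∑ k ∈ S, c k * lap (bracketPow (b k)) x := by
  have h : ∀ k ∈ S, ContDiff ℝ (2 : ℕ)
      fun x : EuclideanSpace ℝ (Fin N) => c k * bracketPow (b k) x :=
    fun k _ => contDiff_const.mul (contDiff_bracketPow _)
  have h2 : ∀ k, iteratedFDeriv ℝ 2 (fun x : EuclideanSpace ℝ (Fin N) => c k * bracketPow (b k) x) x
      = c k • iteratedFDeriv ℝ 2 (bracketPow (b k)) x := fun k =>
    iteratedFDeriv_const_smul_apply (i := 2) (a := c k) (contDiff_bracketPow _).contDiffAt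
  simp only [lap]
  rw [iteratedFDeriv_sum h]
  simp only [Finset.sum_apply, h2, sum_apply, Finset.mul_sum]
  rw [Finset.sum_comm]
  simp

/-- The coefficient of `bracketPow (a + m + k)` in `(-Δ)^m (bracketPow a)` in dimension `2 * n`. -/
noncomputable def lapCoeff (n a : ℝ) (m k : ℕ) : ℝ :=
  4 ^ m * m.choose k * (∏ i ∈ Finset.range (m + k), (a + i))
    * ∏ i ∈ Finset.range (m - k), (n - a - m + i)

lemma lapCoeff_self_succ (n a : ℝ) (m : ℕ) : lapCoeff n a m (m + 1) = 0 := by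
  simp [lapCoeff]

lemma lapCoeff_succ_zero (n a : ℝ) (m : ℕ) :
    lapCoeff n a (m + 1) 0 = 4 * (a + m) * (n - 1 - (a + m)) * lapCoeff n a m 0 := by
  simp only [lapCoeff, add_zero, Nat.sub_zero, Nat.choose_zero_right, Nat.cast_one,
    Finset.prod_range_succ (fun i : ℕ => a + (i : ℝ)) m,
    Finset.prod_range_succ' (fun i : ℕ => n - a - ((m + 1 : ℕ) : ℝ) + (i : ℝ)) m]
  have : ∀ i : ℕ, n - a - ((m + 1 : ℕ) : ℝ) + ((i + 1 : ℕ) : ℝ) = n - a - m + i := by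
    intro i; push_cast; ring
  simp only [this]
  push_cast; ring

lemma lapCoeff_succ_succ (n a : ℝ) {m k : ℕ} (hk : k ≤ m) :
    lapCoeff n a (m + 1) (k + 1) =
      4 * (a + m + (k + 1)) * (n - 1 - (a + m + (k + 1))) * lapCoeff n a m (k + 1)
        + 4 * (a + m + k) * (a + m + k + 1) * lapCoeff n a m k := by
  obtain ⟨j, rfl⟩ := Nat.exists_eq_add_of_le hk
  have hshift : ∀ i : ℕ, n - a - ((k + j + 1 : ℕ) : ℝ) + ((i + 1 : ℕ) : ℝ)
      = n - a - (k + j : ℕ) + i := by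
    intro i; push_cast; ring
  have hch : (((k + j).choose (k + 1) : ℕ) : ℝ) * (k + 1) = (k + j).choose k * j := by
    have := Nat.choose_succ_right_eq (k + j) k
    rw [Nat.add_sub_cancel_left] at this
    exact_mod_cast this
  have e1 : k + j + 1 + (k + 1) = k + j + k + 1 + 1 := by ring
  have e2 : k + j + (k + 1) = k + j + k + 1 := by ring
  have e3 : k + j + 1 - (k + 1) = j := by omega
  have e4 : k + j - k = j := by omega
  have e5 : k + j - (k + 1) = j - 1 := by omega
  simp only [lapCoeff, e1, e2, e3, e4, e5, Nat.choose_succ_succ', pow_succ,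
    Finset.prod_range_succ (fun i : ℕ => a + (i : ℝ))]
  rcases j with _ | j
  · simp
    ring
  · rw [Finset.prod_range_succ' _ j, Finset.prod_range_succ _ j]
    simp only [hshift, Nat.add_sub_cancel]
    push_cast at hch ⊢
    set P := ∏ i ∈ Finset.range (k + (j + 1) + k), (a + (i : ℝ))
    set Q := ∏ i ∈ Finset.range j, (n - a - ((k : ℝ) + (j + 1)) + i)
    linear_combination (4 * 4 ^ (k + (j + 1)) * P * (a + (k + (j + 1) + k))
      * (a + (k + (j + 1) + k + 1)) * Q) * hch

lemma negLapPow_bracketPow {N : ℕ} (ε a : ℝ) (m : ℕ) :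
    negLapPow m (fun x : EuclideanSpace ℝ (Fin N) => ε * bracketPow a x) =
      fun x => ∑ k ∈ Finset.range (m + 1),
        (ε * lapCoeff (N / 2) a m k) * bracketPow (a + m + k) x := by
  induction m with
  | zero => simp [negLapPow, lapCoeff]
  | succ m ih =>
    have h : negLapPow (m + 1) (fun x : EuclideanSpace ℝ (Fin N) => ε * bracketPow a x) =
        fun x => -lap (negLapPow m fun x => ε * bracketPow a x) x :=
      Function.iterate_succ_apply' _ _ _
    rw [h, ih]
    funext x
    rw [lap_sum_bracketPow (Finset.range (m + 1)) (fun k => ε * lapCoeff (N / 2) a m k)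
      (fun k => a + m + k), ← Finset.sum_neg_distrib]
    have e : ∀ k : ℕ, -(ε * lapCoeff (N / 2) a m k * lap (bracketPow (a + m + k)) x)
        = ε * (4 * (a + m + k) * (N / 2 - 1 - (a + m + k)) * lapCoeff (N / 2) a m k)
            * bracketPow (a + (m + 1 : ℕ) + k) x
          + ε * (4 * (a + m + k) * (a + m + k + 1) * lapCoeff (N / 2) a m k)
            * bracketPow (a + (m + 1 : ℕ) + (k + 1 : ℕ)) x := by
      intro k
      rw [← mul_neg, lap_bracketPow]
      push_cast
      rw [show a + (m + 1) + (k : ℝ) = a + m + k + 1 by ring,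
        show a + (m + 1) + ((k : ℝ) + 1) = a + m + k + 2 by ring]
      ring
    have shift : ∀ A : ℕ → ℝ, A (m + 1) = 0 → ∑ k ∈ Finset.range (m + 1), A k
        = ∑ k ∈ Finset.range (m + 1), A (k + 1) + A 0 := fun A hA => by
      rw [← Finset.sum_range_succ', Finset.sum_range_succ _ (m + 1), hA, add_zero]
    rw [Finset.sum_congr rfl fun k _ => e k, Finset.sum_add_distrib,
      shift _ (by rw [lapCoeff_self_succ]; ring), Finset.sum_range_succ' _ (m + 1),
      lapCoeff_succ_zero, add_right_comm, ← Finset.sum_add_distrib]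
    congr 1
    · refine Finset.sum_congr rfl fun k hk => ?_
      rw [lapCoeff_succ_succ _ _ (Nat.lt_succ_iff.1 (Finset.mem_range.1 hk))]
      push_cast
      ring
    · push_cast
      ring

lemma lapCoeff_nonneg {n a : ℝ} (ha : 0 < a) {m : ℕ} (h : a + m < n) (k : ℕ) :
    0 ≤ lapCoeff n a m k := by
  have : 0 < n - a - m := by linarith
  exact mul_nonneg (mul_nonneg (by positivity) (Finset.prod_nonneg fun i _ => by positivity))
    (Finset.prod_nonneg fun i _ => by positivity)

lemma lapCoeff_zero_pos {n a : ℝ} (ha : 0 < a) {m : ℕ} (h : a + m < n) :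
    0 < lapCoeff n a m 0 := by
  have : 0 < n - a - m := by linarith
  exact mul_pos (mul_pos (by simp) (Finset.prod_pos fun i _ => by positivity))
    (Finset.prod_pos fun i _ => by positivity)

lemma le_negLapPow_bracketPow {N : ℕ} {ε a : ℝ} (hε : 0 ≤ ε) (ha : 0 < a) {m : ℕ}
    (h : a + m < N / 2) (x : EuclideanSpace ℝ (Fin N)) :
    ε * lapCoeff (N / 2) a m 0 * bracketPow (a + m) x
      ≤ negLapPow m (fun x => ε * bracketPow a x) x := by
  rw [negLapPow_bracketPow]
  beta_reduce
  rw [Finset.sum_range_succ']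
  simp only [Nat.cast_zero, add_zero]
  exact le_add_of_nonneg_left (Finset.sum_nonneg fun k _ =>
    mul_nonneg (mul_nonneg hε (lapCoeff_nonneg ha h _)) (bracketPow_pos _ _).le)

/-- The profile equal to `r ^ (-s)` on `r ≤ 1` and to `r ^ (-σ)` on `1 < r`. -/
noncomputable def powProfile (s σ r : ℝ) : ℝ :=
  if r ≤ 1 then r ^ (-s) else r ^ (-σ)

lemma powProfile_nonneg {s σ r : ℝ} (hr : 0 ≤ r) : 0 ≤ powProfile s σ r := by
  unfold powProfile; split_ifs <;> positivity

lemma integrable_powProfile_norm {N : ℕ} (hN : 0 < N) {s σ : ℝ} (hs : s < N) (hσ : N < σ) :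
    Integrable fun y : EuclideanSpace ℝ (Fin N) => powProfile s σ ‖y‖ := by
  have : Nonempty (Fin N) := ⟨⟨0, hN⟩⟩
  rw [integrable_fun_norm_addHaar volume (f := powProfile s σ), finrank_euclideanSpace_fin,
    ← Set.Ioc_union_Ioi_eq_Ioi zero_le_one]
  have e : ∀ b : ℝ, ∀ r : ℝ, 0 < r → r ^ (N - 1) * r ^ (-b) = r ^ ((N : ℝ) - 1 - b) := by
    intro b r hr
    rw [← Real.rpow_natCast, ← Real.rpow_add hr, Nat.cast_sub hN, Nat.cast_one, sub_eq_add_neg _ b]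
  refine IntegrableOn.union ?_ ?_
  · have h : IntegrableOn (fun r : ℝ => r ^ ((N : ℝ) - 1 - s)) (Set.Ioc 0 1) := by
      rw [integrableOn_Ioc_iff_integrableOn_Ioo, intervalIntegral.integrableOn_Ioo_rpow_iff one_pos]
      linarith
    refine h.congr_fun (fun r hr => ?_) measurableSet_Ioc
    simp [powProfile, hr.2, e s r hr.1]
  · have h : IntegrableOn (fun r : ℝ => r ^ ((N : ℝ) - 1 - σ)) (Set.Ioi 1) :=
      integrableOn_Ioi_rpow_of_lt (by linarith) one_pos
    refine h.congr_fun (fun r hr => ?_) measurableSet_Ioi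
    simp [powProfile, not_le.2 (Set.mem_Ioi.1 hr), e σ r (one_pos.trans hr)]

lemma rpow_mul_rpow_le_powProfile {t α R r w d : ℝ} (ht : 0 < t) (hα : 0 < α) (hR : 0 < R)
    (hr : 0 < r) (hrw : r ≤ w) (hd : 0 < d) (h : 2 * R ≤ w + d) :
    w ^ (-t) * d ^ (-α) ≤
      R ^ (-(t + α)) * (powProfile t (t + α) (r / R) + powProfile α (t + α) (d / R)) := by
  have hw : 0 < w := hr.trans_le hrw
  have anti : ∀ {b x y : ℝ}, 0 < b → 0 < x → x ≤ y → y ^ (-b) ≤ x ^ (-b) := fun hb hx hxy =>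
    Real.rpow_le_rpow_of_nonpos hx hxy (by linarith)
  have split : ∀ x : ℝ, 0 < x → x ^ (-(t + α)) = x ^ (-t) * x ^ (-α) := fun x hx => by
    rw [← Real.rpow_add hx]; congr 1; ring
  have far : ∀ s x : ℝ, R < x → R ^ (-(t + α)) * powProfile s (t + α) (x / R) = x ^ (-(t + α)) := by
    intro s x hx
    rw [powProfile, if_neg (by rwa [not_le, lt_div_iff₀ hR, one_mul]),
      Real.div_rpow (hR.trans hx).le hR.le]
    field_simp
  have near_left : ∀ x : ℝ, 0 < x → x ≤ R →
      R ^ (-(t + α)) * powProfile t (t + α) (x / R) = x ^ (-t) * R ^ (-α) := by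
    intro x hx hxR
    rw [powProfile, if_pos (by rwa [div_le_one hR]), Real.div_rpow hx.le hR.le, split R hR]
    field_simp
  have near_right : ∀ x : ℝ, 0 < x → x ≤ R →
      R ^ (-(t + α)) * powProfile α (t + α) (x / R) = R ^ (-t) * x ^ (-α) := by
    intro x hx hxR
    rw [powProfile, if_pos (by rwa [div_le_one hR]), Real.div_rpow hx.le hR.le, split R hR]
    field_simp
  have nonneg : ∀ s x : ℝ, 0 < x → 0 ≤ R ^ (-(t + α)) * powProfile s (t + α) (x / R) := fun s x hx =>
    mul_nonneg (by positivity) (powProfile_nonneg (by positivity))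
  have n1 := nonneg t r hr
  have n2 := nonneg α d hd
  rw [mul_add]
  rcases le_or_gt d R with hdR | hdR
  · refine le_add_of_nonneg_of_le n1 ?_
    rw [near_right d hd hdR]
    exact mul_le_mul_of_nonneg_right (anti ht hR (by linarith)) (by positivity)
  rcases le_or_gt d w with hdw | hdw
  · refine le_add_of_nonneg_of_le n1 ?_
    rw [far α d hdR, split d hd]
    exact mul_le_mul_of_nonneg_right (anti ht hd hdw) (by positivity)
  · refine le_add_of_le_of_nonneg ?_ n2
    rcases le_or_gt r R with hrR | hrR
    · rw [near_left r hr hrR]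
      exact mul_le_mul (anti ht hr hrw) (anti hα hR hdR.le) (by positivity) (by positivity)
    · rw [far t r hrR, split r hr]
      exact mul_le_mul (anti ht hr hrw) (anti hα hr (hrw.trans hdw.le)) (by positivity)
        (by positivity)

lemma sqrt_one_add_norm_sq_le_add {N : ℕ} (x y : EuclideanSpace ℝ (Fin N)) :
    √(1 + ‖x‖ ^ 2) ≤ √(1 + ‖y‖ ^ 2) + ‖y - x‖ := by
  have h1 : ‖x‖ ≤ ‖y‖ + ‖y - x‖ := by
    simpa using norm_sub_le y (y - x)
  have h2 : ‖y‖ ≤ √(1 + ‖y‖ ^ 2) := Real.le_sqrt_of_sq_le (by linarith)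
  have h3 := Real.sq_sqrt (show 0 ≤ 1 + ‖y‖ ^ 2 by positivity)
  refine Real.sqrt_le_iff.2 ⟨by positivity, ?_⟩
  nlinarith [norm_nonneg x, norm_nonneg y, norm_nonneg (y - x),
    mul_le_mul_of_nonneg_right h2 (norm_nonneg (y - x))]

lemma bracketPow_eq_sqrt_rpow {N : ℕ} (t : ℝ) (x : EuclideanSpace ℝ (Fin N)) :
    bracketPow (t / 2) x = √(1 + ‖x‖ ^ 2) ^ (-t) := by
  rw [bracketPow, Real.sqrt_eq_rpow, ← Real.rpow_mul (by positivity)]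
  congr 1; ring

/-- Riesz potentials of powers of the Japanese bracket are integrable and decay accordingly. -/
lemma exists_integral_bracketPow_mul_le {N : ℕ} {t α : ℝ} (ht : 0 < t) (htN : t < N)
    (hα : 0 < α) (hαN : α < N) (htα : N < t + α) :
    ∃ C : ℝ, 0 ≤ C ∧ ∀ x : EuclideanSpace ℝ (Fin N),
      Integrable (fun y => bracketPow (t / 2) y * ‖y - x‖ ^ (-α)) ∧
      ∫ y, bracketPow (t / 2) y * ‖y - x‖ ^ (-α) ≤ C * bracketPow ((t + α - N) / 2) x := by
  have hN : 0 < N := by exact_mod_cast hα.trans hαN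
  have : Nonempty (Fin N) := ⟨⟨0, hN⟩⟩
  set F : EuclideanSpace ℝ (Fin N) → ℝ := fun y => powProfile t (t + α) ‖y‖
  set G : EuclideanSpace ℝ (Fin N) → ℝ := fun y => powProfile α (t + α) ‖y‖
  have hF : Integrable F := integrable_powProfile_norm hN htN htα
  have hG : Integrable G := integrable_powProfile_norm hN hαN htα
  refine ⟨2 ^ (t + α - N) * ((∫ y, F y) + ∫ y, G y), ?_, fun x => ?_⟩
  · exact mul_nonneg (by positivity) (add_nonneg
      (integral_nonneg fun y => powProfile_nonneg (norm_nonneg _))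
      (integral_nonneg fun y => powProfile_nonneg (norm_nonneg _)))
  set J := √(1 + ‖x‖ ^ 2) with hJ
  have hJ0 : 0 < J := Real.sqrt_pos.2 (by positivity)
  set R := J / 2 with hR
  have hR0 : 0 < R := by positivity
  have hFR : Integrable fun y => F (R⁻¹ • y) := hF.comp_smul (inv_ne_zero hR0.ne')
  have hGR : Integrable fun y => G (R⁻¹ • y) := hG.comp_smul (inv_ne_zero hR0.ne')
  have hGx : Integrable fun y => G (R⁻¹ • (y - x)) := hGR.comp_sub_right x
  have hint : Integrable fun y => R ^ (-(t + α)) * (F (R⁻¹ • y) + G (R⁻¹ • (y - x))) :=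
    (hFR.add hGx).const_mul _
  have hnn : ∀ y, 0 ≤ bracketPow (t / 2) y * ‖y - x‖ ^ (-α) := fun y =>
    mul_nonneg (bracketPow_pos _ _).le (by positivity)
  have hle : ∀ᵐ y : EuclideanSpace ℝ (Fin N), bracketPow (t / 2) y * ‖y - x‖ ^ (-α) ≤
      R ^ (-(t + α)) * (F (R⁻¹ • y) + G (R⁻¹ • (y - x))) := by
    filter_upwards [Measure.ae_ne volume (0 : EuclideanSpace ℝ (Fin N)), Measure.ae_ne volume x]
      with y hy hyx
    have := rpow_mul_rpow_le_powProfile (w := √(1 + ‖y‖ ^ 2)) ht hα hR0 (norm_pos_iff.2 hy)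
      (Real.le_sqrt_of_sq_le (by linarith)) (norm_pos_iff.2 (sub_ne_zero.2 hyx))
      (by have := sqrt_one_add_norm_sq_le_add x y; linarith)
    rw [bracketPow_eq_sqrt_rpow]
    simpa only [F, G, norm_smul, norm_inv, Real.norm_of_nonneg hR0.le,
      div_eq_inv_mul] using this
  have hmeas : AEStronglyMeasurable
      (fun y : EuclideanSpace ℝ (Fin N) => bracketPow (t / 2) y * ‖y - x‖ ^ (-α)) volume := by
    refine Measurable.aestronglyMeasurable ?_
    exact (contDiff_bracketPow (n := 0) _).continuous.measurable.mul
      ((measurable_id.sub_const x).norm.pow_const _)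
  refine ⟨hint.mono' hmeas ?_, ?_⟩
  · filter_upwards [hle] with y hy
    rwa [Real.norm_of_nonneg (hnn y)]
  · refine (integral_mono_of_nonneg (Eventually.of_forall hnn) hint hle).trans_eq ?_
    rw [integral_const_mul, integral_add hFR hGx,
      integral_sub_right_eq_self (fun y => G (R⁻¹ • y)) x,
      Measure.integral_comp_inv_smul, Measure.integral_comp_inv_smul, finrank_euclideanSpace_fin,
      abs_of_pos (by positivity), bracketPow_eq_sqrt_rpow, ← hJ, ← smul_add, smul_eq_mul,
      ← mul_assoc, ← Real.rpow_natCast, ← Real.rpow_add hR0, hR, Real.div_rpow hJ0.le zero_le_two,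
      show -(t + α) + (N : ℝ) = -(t + α - N) by ring, Real.rpow_neg zero_le_two]
    field_simp

lemma exists_decay_exponents {n k α p q : ℝ} (hk : 0 < k) (hkn : k < n) (hα0 : 0 < α)
    (hp : 0 < p) (hpk : n - α < p * k) (hqk : n - α < q * k)
    (hpq : 2 * n - α < (p + q) * k) :
    ∃ s t : ℝ, 0 < s ∧ s < k ∧ 0 < t ∧ t < n ∧ n < t + α ∧ t ≤ s * p ∧
      s + (n - k) ≤ t + α - n + s * q := by
  have small : ∀ b c : ℝ, 0 < c → ∀ᶠ δ in nhdsWithin (0 : ℝ) (Set.Ioi 0), b * δ < c := by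
    intro b c hc
    have h : Tendsto (fun δ : ℝ => b * δ) (nhds 0) (nhds (b * 0)) :=
      (continuous_const.mul continuous_id).tendsto 0
    rw [mul_zero] at h
    exact (h.mono_left nhdsWithin_le_nhds).eventually_lt_const hc
  obtain ⟨δ, h0, h1, h2, h3, h4, h5⟩ := ((eventually_mem_nhdsWithin (a := (0 : ℝ))
    (s := Set.Ioi 0)).and ((small 1 k hk).and ((small 1 α hα0).and
      ((small p _ (sub_pos.2 hpk)).and ((small q _ (sub_pos.2 hqk)).and
        (small (p + q) _ (sub_pos.2 hpq))))))).exists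
  have h0 : 0 < δ := h0
  refine ⟨k - δ, min ((k - δ) * p) (n - δ), by linarith, by linarith,
    lt_min (mul_pos (by linarith) hp) (by linarith), (min_le_right _ _).trans_lt (by linarith),
    ?_, min_le_left _ _, ?_⟩
  · rw [← sub_lt_iff_lt_add]
    exact lt_min (by linarith) (by linarith)
  · rcases min_cases ((k - δ) * p) (n - δ) with ⟨h, -⟩ | ⟨h, -⟩ <;> rw [h] <;> linarith

lemma exists_pos_rpow_mul_le {c C r : ℝ} (hc : 0 < c) (hr : 1 < r) :
    ∃ ε : ℝ, 0 < ε ∧ ε ^ r * C ≤ ε * c := by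
  have h : Tendsto (fun ε : ℝ => ε ^ (r - 1) * C) (nhds 0) (nhds (0 ^ (r - 1) * C)) :=
    ((Real.continuousAt_rpow_const 0 (r - 1) (Or.inr (by linarith))).tendsto).mul_const C
  rw [Real.zero_rpow (by linarith), zero_mul] at h
  obtain ⟨ε, h0, h1⟩ := ((eventually_mem_nhdsWithin (a := (0 : ℝ)) (s := Set.Ioi 0)).and
    ((h.mono_left nhdsWithin_le_nhds).eventually_lt_const hc)).exists
  have h0 : 0 < ε := h0
  refine ⟨ε, h0, ?_⟩
  have := mul_le_mul_of_nonneg_left h1.le h0.le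
  rwa [← mul_assoc, Real.rpow_sub_one h0.ne', mul_div_cancel₀ _ h0.ne'] at this

theorem stmt_7 (N m : ℕ) (hm : 1 ≤ m) (hN : 2 * m < N)
    (α : ℝ) (hα0 : 0 < α) (hαN : α < N)
    (p q : ℝ) (hp : 1 ≤ p) (hq : 1 < q)
    (hmin : ((N : ℝ) - α) / ((N : ℝ) - 2 * m) < min p q)
    (hsum : (2 * (N : ℝ) - α) / ((N : ℝ) - 2 * m) < p + q) :
    ∃ u : EuclideanSpace ℝ (Fin N) → ℝ,
      ContDiff ℝ (2 * m) u ∧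
      (∀ x, 0 < u x) ∧
      IntegrableOn (fun y : EuclideanSpace ℝ (Fin N) => u y ^ p * (‖y‖ / 2) ^ (-α))
        {y : EuclideanSpace ℝ (Fin N) | 1 < ‖y‖} ∧
      (∀ x : EuclideanSpace ℝ (Fin N),
        (∫ y : EuclideanSpace ℝ (Fin N), u y ^ p * ‖y - x‖ ^ (-α)) * u x ^ q
          ≤ negLapPow m u x) := by
  have hmN : 2 * (m : ℝ) < N := by exact_mod_cast hN
  have hm0 : 1 ≤ (m : ℝ) := by exact_mod_cast hm
  have hk : 0 < (N : ℝ) - 2 * m := by linarith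
  rw [lt_min_iff, div_lt_iff₀ hk, div_lt_iff₀ hk] at hmin
  rw [div_lt_iff₀ hk] at hsum
  obtain ⟨s, t, hs0, hsk, ht0, htN, htα, htp, hdecay⟩ := exists_decay_exponents hk (by linarith)
    hα0 (by linarith) hmin.1 hmin.2 hsum
  obtain ⟨C, hC0, hC⟩ := exists_integral_bracketPow_mul_le ht0 htN hα0 hαN htα
  have ha0 : 0 < s / 2 := by positivity
  have ham : s / 2 + m < (N : ℝ) / 2 := by linarith
  obtain ⟨ε, hε0, hε⟩ := exists_pos_rpow_mul_le (C := C) (lapCoeff_zero_pos ha0 ham)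
    (show 1 < p + q by linarith)
  have hpow : ∀ r : ℝ, ∀ y : EuclideanSpace ℝ (Fin N),
      (ε * bracketPow (s / 2) y) ^ r = ε ^ r * bracketPow (s / 2 * r) y := fun r y => by
    rw [Real.mul_rpow hε0.le (bracketPow_pos _ _).le, bracketPow_rpow]
  have hle : ∀ y : EuclideanSpace ℝ (Fin N),
      (ε * bracketPow (s / 2) y) ^ p ≤ ε ^ p * bracketPow (t / 2) y := fun y => by
    rw [hpow]
    exact mul_le_mul_of_nonneg_left (bracketPow_anti (by linarith) y) (by positivity)
  have hu0 : ∀ y : EuclideanSpace ℝ (Fin N), 0 < ε * bracketPow (s / 2) y := fun y =>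
    mul_pos hε0 (bracketPow_pos _ y)
  refine ⟨fun x => ε * bracketPow (s / 2) x, contDiff_const.mul (contDiff_bracketPow _), hu0,
    ?_, fun x => ?_⟩
  · have hint := ((hC 0).1.const_mul (ε ^ p * 2 ^ α)).integrableOn
      (s := {y : EuclideanSpace ℝ (Fin N) | 1 < ‖y‖})
    refine hint.mono' (Measurable.aestronglyMeasurable ?_) (Eventually.of_forall fun y => ?_)
    · exact ((continuous_const.mul
        (contDiff_bracketPow (n := 0) _).continuous).measurable.pow_const _).mul
        ((measurable_norm.div_const _).pow_const _)
    · rw [Real.norm_of_nonneg (mul_nonneg (Real.rpow_nonneg (hu0 y).le _) (by positivity)),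
        Real.div_rpow (norm_nonneg _) zero_le_two, Real.rpow_neg zero_le_two, div_inv_eq_mul,
        sub_zero]
      refine (mul_le_mul_of_nonneg_right (hle y) (by positivity)).trans_eq ?_
      ring
  · have hI : ∫ y, (ε * bracketPow (s / 2) y) ^ p * ‖y - x‖ ^ (-α) ≤
        ε ^ p * (C * bracketPow ((t + α - N) / 2) x) := by
      refine le_trans ?_ (mul_le_mul_of_nonneg_left (hC x).2 (by positivity))
      rw [← integral_const_mul]
      refine integral_mono_of_nonneg (Eventually.of_forall fun y => ?_) ((hC x).1.const_mul _)
        (Eventually.of_forall fun y => ?_)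
      · exact mul_nonneg (Real.rpow_nonneg (hu0 y).le _) (by positivity)
      · exact (mul_le_mul_of_nonneg_right (hle y) (by positivity)).trans_eq (mul_assoc _ _ _)
    refine le_trans ?_ (le_negLapPow_bracketPow hε0.le ha0 ham x)
    calc _ ≤ ε ^ p * (C * bracketPow ((t + α - N) / 2) x) * (ε ^ q * bracketPow (s / 2 * q) x) := by
          rw [← hpow]
          exact mul_le_mul_of_nonneg_right hI (Real.rpow_nonneg (hu0 x).le _)
      _ = ε ^ (p + q) * C * bracketPow ((t + α - N) / 2 + s / 2 * q) x := by
          rw [← bracketPow_mul, Real.rpow_add hε0]; ring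
      _ ≤ ε ^ (p + q) * C * bracketPow (s / 2 + m) x :=
          mul_le_mul_of_nonneg_left (bracketPow_anti (by linarith) x) (by positivity)
      _ ≤ _ := mul_le_mul_of_nonneg_right hε (bracketPow_pos _ _).le
end
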